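/- arXiv:2305.01354 — 4 statements merged into one kernel-verified Lean document; each statement's English description precedes it below -/
import Mathlib

section
/- Let (b,c) be a connected graph over X with a nilpotent group G acting cocompactly on X such that H_{b,c} is G-invariant, and fix x₀ ∈ X. Then for every f ∈ 𝓗⁺ there exists a Borel probability measure μ_f on 𝓚, concentrated on the set of harmonic and G-multiplicative elements of 𝓚, such that f(x) = f(x₀) · ∫_𝓚 k(x) dμ_f(k) for all x ∈ X. -/
open MeasureTheory
open scoped BigOperators

noncomputable section

namespace GraphPaper

variable {X : Type*}

/-- The Schrödinger operator `H_{b,c}` of a graph `(b,c)` over `X`. -/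
def schrodinger (b : X → X → ℝ) (c : X → ℝ) (f : X → ℝ) : X → ℝ :=
  fun x => (∑' y, b x y * (f x - f y)) + c x * f x

/-- Membership of `f` in the domain of `H_{b,c}`. -/
def InDom (b : X → X → ℝ) (f : X → ℝ) : Prop :=
  ∀ x, Summable fun y => b x y * |f y|

/-- The graph `b` is connected: any two points are joined by a path of positive weights. -/
def Connected (b : X → X → ℝ) : Prop :=
  ∀ x y : X, Relation.ReflTransGen (fun u v => 0 < b u v) x y

/-- The degree `deg(x) = ∑_y b(x,y) + c(x)`. -/
def deg (b : X → X → ℝ) (c : X → ℝ) (x : X) : ℝ :=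
  (∑' y, b x y) + c x

variable {G : Type*} [Group G] [MulAction G X]

/-- The shift `T_g f (x) = f (g⁻¹ x)`. -/
def shift (g : G) (f : X → ℝ) : X → ℝ := fun x => f (g⁻¹ • x)

/-- `H_{b,c}` is invariant under the shifts by elements of a set `R ⊆ G`. -/
def HInvOn (b : X → X → ℝ) (c : X → ℝ) (R : Set G) : Prop :=
  ∀ g ∈ R, ∀ f : X → ℝ, InDom b f →
    InDom b (shift g f) ∧ schrodinger b c (shift g f) = shift g (schrodinger b c f)

/-- The action of `G` on `X` is cocompact: there is a finite `V` with `G V = X`. -/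
def CocompactAction (G X : Type*) [Group G] [MulAction G X] : Prop :=
  ∃ V : Finset X, ∀ x : X, ∃ g : G, ∃ v ∈ V, x = g • v

/-- The set `𝓗⁺` of nonnegative, not identically zero, harmonic functions. -/
def Hplus (b : X → X → ℝ) (c : X → ℝ) : Set (X → ℝ) :=
  {f | InDom b f ∧ schrodinger b c f = 0 ∧ (∀ x, 0 ≤ f x) ∧ f ≠ 0}

/-- The set `𝓚`: the closure of the normalized positive harmonic functions. -/
def Kset (b : X → X → ℝ) (c : X → ℝ) (x₀ : X) : Set (X → ℝ) :=
  closure {f : X → ℝ | f ∈ Hplus b c ∧ f x₀ = 1}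

/-- The set `𝓚^R` of `R`-invariant elements of `𝓚`. -/
def KsetR (b : X → X → ℝ) (c : X → ℝ) (x₀ : X) (R : Set G) : Set (X → ℝ) :=
  {f ∈ Kset b c x₀ | ∀ g ∈ R, shift g f = f}

/-- `f` is `G`-multiplicative with a character `γ ∈ Hom(G, ℝ_{>0})`. -/
def IsMultiplicative (G : Type*) [Group G] [MulAction G X] (f : X → ℝ) : Prop :=
  ∃ γ : G →* ℝ, (∀ g, 0 < γ g) ∧ ∀ g : G, shift g f = γ g⁻¹ • f

/-- `Q(R) = π⁻¹(Z(G/R))`, the preimage of the centre of `G/R`. -/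
def Qsub (R : Subgroup G) [R.Normal] : Subgroup G :=
  (Subgroup.center (G ⧸ R)).comap (QuotientGroup.mk' R)

/-- The set `𝓜` of multiplicative elements of `𝓚`. -/
def Mset (G : Type*) [Group G] [MulAction G X] (b : X → X → ℝ) (c : X → ℝ) (x₀ : X) :
    Set (X → ℝ) :=
  {f ∈ Kset b c x₀ | IsMultiplicative G f}

/-- The set `𝓚_λ` for the graph `(b, c - λ)`, i.e. for `λ`-harmonic functions. -/
def KsetLam (b : X → X → ℝ) (c : X → ℝ) (x₀ : X) (l : ℝ) : Set (X → ℝ) :=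
  closure {f : X → ℝ | InDom b f ∧ (schrodinger b c f = fun x => l * f x) ∧
    (∀ x, 0 ≤ f x) ∧ f ≠ 0 ∧ f x₀ = 1}

/-- The set `𝓜_λ` of multiplicative elements of `𝓚_λ`. -/
def MsetLam (G : Type*) [Group G] [MulAction G X] (b : X → X → ℝ) (c : X → ℝ) (x₀ : X)
    (l : ℝ) : Set (X → ℝ) :=
  {f ∈ KsetLam b c x₀ l | IsMultiplicative G f}


theorem exists_rep {X : Type*} [Countable X] {M : Set (X → ℝ)} (hM : IsCompact M)
    {p : X → ℝ} (hp : p ∈ closure (convexHull ℝ M)) :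
    ∃ μ : Measure (X → ℝ), IsProbabilityMeasure μ ∧ (∀ᵐ k ∂μ, k ∈ M) ∧
      ∀ x, Integrable (fun k : X → ℝ => k x) μ ∧ p x = ∫ k, k x ∂μ := by
  have : CompactSpace M := isCompact_iff_compactSpace.mp hM
  let ev : X → BoundedContinuousFunction M ℝ := fun x =>
    BoundedContinuousFunction.mkOfCompact ⟨fun k => k.1 x, (continuous_apply x).comp continuous_subtype_val⟩
  let Bar : ProbabilityMeasure M → (X → ℝ) := fun ν x => ∫ k, ev x k ∂(ν : Measure M)
  have hc : Continuous Bar := by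
    apply continuous_pi
    intro x
    exact ProbabilityMeasure.continuous_integral_boundedContinuousFunction (ev x)
  have hcl : IsClosed (Set.range Bar) := (isCompact_range hc).isClosed
  have hint : ∀ (ν : Measure M) [IsFiniteMeasure ν] x, Integrable (fun k => ev x k) ν :=
    fun ν _ x => (ev x).integrable ν
  have hconv : Convex ℝ (Set.range Bar) := by
    rintro _ ⟨ν, rfl⟩ _ ⟨ν', rfl⟩ a b ha hb hab
    have hpr : IsProbabilityMeasure
        (ENNReal.ofReal a • (ν : Measure M) + ENNReal.ofReal b • (ν' : Measure M)) := by
      constructor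
      simp [← ENNReal.ofReal_add ha hb, hab]
    refine ⟨⟨_, hpr⟩, ?_⟩
    funext x
    simp only [Bar, ProbabilityMeasure.coe_mk, Pi.add_apply, Pi.smul_apply, smul_eq_mul]
    rw [integral_add_measure, integral_smul_measure, integral_smul_measure]
    · simp [ENNReal.toReal_ofReal ha, ENNReal.toReal_ofReal hb]
    · exact (hint _ x).smul_measure (by simp)
    · exact (hint _ x).smul_measure (by simp)
  have hsub : M ⊆ Set.range Bar := by
    intro m hm
    refine ⟨⟨Measure.dirac ⟨m, hm⟩, inferInstance⟩, ?_⟩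
    funext x
    simp only [Bar, ProbabilityMeasure.coe_mk]
    rw [integral_dirac]
    rfl
  obtain ⟨ν, hν⟩ := closure_minimal (convexHull_min hsub hconv) hcl hp
  have hmeas : Measurable (Subtype.val : M → X → ℝ) := measurable_subtype_coe
  refine ⟨(ν : Measure M).map Subtype.val, Measure.isProbabilityMeasure_map hmeas.aemeasurable,
    ?_, fun x => ⟨?_, ?_⟩⟩
  · exact (ae_map_iff (p := fun k => k ∈ M) hmeas.aemeasurable hM.isClosed.measurableSet).2
      (Filter.Eventually.of_forall fun k => k.2)
  · rw [integrable_map_measure (measurable_pi_apply x).aestronglyMeasurable hmeas.aemeasurable]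
    exact hint _ x
  · rw [integral_map hmeas.aemeasurable (measurable_pi_apply x).aestronglyMeasurable, ← hν]
    rfl

section Abstract

theorem K_val {X : Type*} {N : Set (X → ℝ)} {x₀ : X} (hN1 : ∀ k ∈ N, k x₀ = 1)
    {k : X → ℝ} (hk : k ∈ closure N) : k x₀ = 1 := by
  have hc : IsClosed {k : X → ℝ | k x₀ = 1} :=
    isClosed_eq (continuous_apply x₀) continuous_const
  exact closure_minimal (s := N) hN1 hc hk

theorem K_nonneg {X : Type*} {N : Set (X → ℝ)} (hN0 : ∀ k ∈ N, ∀ x, 0 ≤ k x)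
    {k : X → ℝ} (hk : k ∈ closure N) (x : X) : 0 ≤ k x := by
  have hc : IsClosed {k : X → ℝ | 0 ≤ k x} :=
    isClosed_le continuous_const (continuous_apply x)
  exact closure_minimal (s := N) (fun k hk => hN0 k hk x) hc hk

variable {X : Type*} {G : Type*} [Group G] [MulAction G X]

theorem K_har {N : Set (X → ℝ)}
    (hHar : ∀ x y : X, ∃ C : ℝ, 0 < C ∧ ∀ k ∈ N, ∀ h : G, k (h • y) ≤ C * k (h • x)) (x y : X) :
    ∃ C : ℝ, 0 < C ∧ ∀ k ∈ closure N, ∀ h : G, k (h • y) ≤ C * k (h • x) := by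
  obtain ⟨C, hC, H⟩ := hHar x y
  refine ⟨C, hC, fun k hk h => ?_⟩
  have hc : IsClosed {k : X → ℝ | k (h • y) ≤ C * k (h • x)} :=
    isClosed_le (continuous_apply _) (continuous_const.mul (continuous_apply _))
  exact closure_minimal (s := N) (fun k hk => H k hk h) hc hk

theorem K_compact {N : Set (X → ℝ)} {x₀ : X} (hN1 : ∀ k ∈ N, k x₀ = 1)
    (hN0 : ∀ k ∈ N, ∀ x, 0 ≤ k x)
    (hHar : ∀ x y : X, ∃ C : ℝ, 0 < C ∧ ∀ k ∈ N, ∀ h : G, k (h • y) ≤ C * k (h • x)) :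
    IsCompact (closure N) := by
  choose C hC H using fun y => hHar x₀ y
  have h1 : IsCompact (Set.pi Set.univ fun y => Set.Icc 0 (C y)) :=
    isCompact_univ_pi fun y => isCompact_Icc
  refine h1.of_isClosed_subset isClosed_closure (closure_minimal ?_ h1.isClosed)
  intro k hk y _
  refine ⟨hN0 k hk y, ?_⟩
  have := H y k hk 1
  simpa [hN1 k hk] using this

theorem K_pos {N : Set (X → ℝ)} {x₀ : X} (hN1 : ∀ k ∈ N, k x₀ = 1)
    (hHar : ∀ x y : X, ∃ C : ℝ, 0 < C ∧ ∀ k ∈ N, ∀ h : G, k (h • y) ≤ C * k (h • x))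
    {k : X → ℝ} (hk : k ∈ closure N) (x : X) : 0 < k x := by
  obtain ⟨C, hC, H⟩ := K_har hHar x x₀
  have := H k hk 1
  rw [one_smul, one_smul, K_val hN1 hk] at this
  by_contra h
  have : C * k x ≤ 0 := mul_nonpos_of_nonneg_of_nonpos hC.le (not_lt.mp h)
  linarith

/-- Extreme points are multiplicative along elements satisfying a global Harnack bound. -/
theorem ext_step {N : Set (X → ℝ)} {x₀ : X} (hN1 : ∀ k ∈ N, k x₀ = 1)
    (hN0 : ∀ k ∈ N, ∀ x, 0 ≤ k x)
    (hHar : ∀ x y : X, ∃ C : ℝ, 0 < C ∧ ∀ k ∈ N, ∀ h : G, k (h • y) ≤ C * k (h • x))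
    (hlin : ∀ k ∈ N, ∀ g : G, ∀ α β : ℝ, (∀ x, 0 ≤ α * k x + β * k (g • x)) →
      α * k x₀ + β * k (g • x₀) = 1 → (fun x => α * k x + β * k (g • x)) ∈ N)
    (g : G) (C : ℝ) (hC : 0 < C) (hb : ∀ k ∈ closure N, ∀ x, k (g • x) ≤ C * k x)
    {k : X → ℝ} (hk : k ∈ (closure N).extremePoints ℝ) (x : X) :
    k (g • x) = k (g • x₀) * k x := by
  have hkK : k ∈ closure N := hk.1
  set a := k (g • x₀) with ha
  have hapos : 0 < a := K_pos hN1 hHar hkK _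
  have haC : a ≤ C := by simpa [K_val hN1 hkK] using hb k hkK x₀
  have key : ∀ A B : (X → ℝ) → ℝ, ContinuousAt A k → ContinuousAt B k →
      (∀ k' ∈ N, ∀ x, 0 ≤ A k' * k' x + B k' * k' (g • x)) →
      (∀ k' ∈ N, A k' * k' x₀ + B k' * k' (g • x₀) = 1) →
      (fun x => A k * k x + B k * k (g • x)) ∈ closure N := by
    intro A B hA hB h0 h1
    let Φ : (X → ℝ) → (X → ℝ) := fun k' x => A k' * k' x + B k' * k' (g • x)
    have hΦ : ContinuousAt Φ k := by
      apply continuousAt_pi.2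
      intro x
      exact (hA.mul (continuous_apply x).continuousAt).add
        (hB.mul (continuous_apply (g • x)).continuousAt)
    have := hΦ.continuousWithinAt.mem_closure_image hkK
    refine closure_mono ?_ this
    rintro _ ⟨k', hk', rfl⟩
    exact hlin k' hk' g _ _ (h0 k' hk') (h1 k' hk')
  have hcont : ContinuousAt (fun k' : X → ℝ => k' (g • x₀)) k :=
    (continuous_apply (g • x₀)).continuousAt
  have hA := key (fun _ => 0) (fun k' => (k' (g • x₀))⁻¹) continuousAt_const
    (hcont.inv₀ hapos.ne')
    (fun k' hk' x => by
      have h1 := hN0 k' hk' (g • x₀)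
      have h2 := hN0 k' hk' (g • x)
      simp only [zero_mul, zero_add]
      exact mul_nonneg (inv_nonneg.2 h1) h2)
    (fun k' hk' => by
      have h1 := K_pos hN1 hHar (subset_closure hk') (g • x₀)
      field_simp
      simp)
  have hd : ∀ k' ∈ N, 0 < 2 * C - k' (g • x₀) := fun k' hk' => by
    have := hb k' (subset_closure hk') x₀
    rw [hN1 k' hk'] at this
    linarith
  have hB := key (fun k' => 2 * C * (2 * C - k' (g • x₀))⁻¹)
    (fun k' => - (2 * C - k' (g • x₀))⁻¹)
    (continuousAt_const.mul ((continuousAt_const.sub hcont).inv₀ (by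
      change 2 * C - a ≠ 0
      linarith)))
    ((continuousAt_const.sub hcont).inv₀ (by
      change 2 * C - a ≠ 0
      linarith)).neg
    (fun k' hk' x => by
      have h1 := inv_pos.2 (hd k' hk')
      have h2 := hb k' (subset_closure hk') x
      have h3 := hN0 k' hk' x
      have h4 : 0 ≤ (2 * C - k' (g • x₀))⁻¹ * (2 * C * k' x - k' (g • x)) := by
        apply mul_nonneg h1.le
        nlinarith
      linarith)
    (fun k' hk' => by
      have h1 := hd k' hk'
      rw [hN1 k' hk']
      field_simp
      ring)
  have h2C : 0 < 2 * C - a := by linarith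
  have := hk.2 hA hB ⟨a / (2 * C), (2 * C - a) / (2 * C), by positivity, by positivity,
    by field_simp; ring, by
      funext x
      simp only [Pi.add_apply, Pi.smul_apply, smul_eq_mul, ← ha]
      field_simp
      ring⟩
  have h := congrFun this x
  simp only [← ha] at h
  rw [← h]
  field_simp
  simp

theorem comm_pow {k : X → ℝ} {g h : G} {t : ℝ}
    (H : ∀ (w : G) x, k (w • g • h • x) = t * k (w • h • g • x)) (n : ℕ) (x : X) :
    k (g ^ n • h ^ n • x) = t ^ (n * n) * k (h ^ n • g ^ n • x) := by
  have h1 : ∀ (m : ℕ) (w : G) x, k (w • g • h ^ m • x) = t ^ m * k (w • h ^ m • g • x) := by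
    intro m
    induction m with
    | zero => intro w x; simp
    | succ m ih =>
      intro w x
      rw [pow_succ' h, mul_smul, H w, ← mul_smul w h, ih, mul_smul, mul_smul, pow_succ]
      ring
  have h2 : ∀ (n : ℕ) (m : ℕ) x, k (g ^ n • h ^ m • x) = t ^ (n * m) * k (h ^ m • g ^ n • x) := by
    intro n m
    induction n with
    | zero => intro x; simp
    | succ n ih =>
      intro x
      rw [pow_succ, mul_smul, h1, ih, mul_smul, Nat.succ_mul, pow_add]
      ring
  exact h2 n n x

theorem le_one_of_pow_bound {t E : ℝ} (hE : 0 < E)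
    (H : ∀ n : ℕ, t ^ (n * n) ≤ E ^ n) : t ≤ 1 := by
  by_contra hlt
  push Not at hlt
  obtain ⟨n, hn⟩ := pow_unbounded_of_one_lt E hlt
  have hn0 : 0 < n + 1 := n.succ_pos
  have h1 := H (n + 1)
  rw [pow_mul] at h1
  have h2 := le_of_pow_le_pow_left₀ hn0.ne' hE.le h1
  have h3 : t ^ n ≤ t ^ (n + 1) := pow_le_pow_right₀ hlt.le n.le_succ
  linarith

theorem pow_har {k : X → ℝ} {x₀ : X} {s : G} {C : ℝ} (hC : 0 < C)
    (H : ∀ w : G, k (w • s • x₀) ≤ C * k (w • x₀)) 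
    (H' : ∀ w : G, k (w • x₀) ≤ C * k (w • s • x₀)) (n : ℕ) (w : G) : 
    k (w • s ^ n • x₀) ≤ C ^ n * k (w • x₀) ∧ k (w • x₀) ≤ C ^ n * k (w • s ^ n • x₀) := by
  induction n with
  | zero => simp
  | succ n ih =>
    have h1 := H (w * s ^ n)
    have h2 := H' (w * s ^ n)
    simp only [mul_smul] at h1 h2
    rw [pow_succ s, mul_smul, pow_succ C]
    have hp := pow_pos hC n
    constructor
    · nlinarith [ih.1]
    · nlinarith [ih.2, mul_le_mul_of_nonneg_left h2 hp.le]

theorem commutator_trivial {k : X → ℝ} {x₀ : X} {g h : G} {t : ℝ} (ht : 0 < t)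
    (hpos : ∀ x, 0 < k x)
    (hHar : ∀ s : G, ∃ C : ℝ, 0 < C ∧ ∀ w : G, k (w • s • x₀) ≤ C * k (w • x₀) ∧
      k (w • x₀) ≤ C * k (w • s • x₀))
    (H : ∀ (w : G) x, k (w • g • h • x) = t * k (w • h • g • x)) : t = 1 := by
  obtain ⟨C, hC, HC⟩ := hHar g
  obtain ⟨D, hD, HD⟩ := hHar h
  have hg := pow_har hC (fun w => (HC w).1) (fun w => (HC w).2)
  have hh := pow_har hD (fun w => (HD w).1) (fun w => (HD w).2)
  have key : ∀ n : ℕ, k (g ^ n • h ^ n • x₀) ≤ ((C * D) * (C * D)) ^ n * k (h ^ n • g ^ n • x₀) ∧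
      k (h ^ n • g ^ n • x₀) ≤ ((C * D) * (C * D)) ^ n * k (g ^ n • h ^ n • x₀) := by
    intro n
    have a1 := hh n (g ^ n)
    have a2 := hg n 1
    have b1 := hg n (h ^ n)
    have b2 := hh n 1
    simp only [one_smul] at a2 b2
    have hCn := pow_pos hC n
    have hDn := pow_pos hD n
    rw [mul_pow, mul_pow]
    constructor
    · calc _ ≤ D ^ n * k (g ^ n • x₀) := a1.1
        _ ≤ D ^ n * (C ^ n * k x₀) := by gcongr; exact a2.1
        _ ≤ D ^ n * (C ^ n * (D ^ n * k (h ^ n • x₀))) := by gcongr; exact b2.2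
        _ ≤ D ^ n * (C ^ n * (D ^ n * (C ^ n * k (h ^ n • g ^ n • x₀)))) := by
          gcongr; exact b1.2
        _ = _ := by ring
    · calc _ ≤ C ^ n * k (h ^ n • x₀) := b1.1
        _ ≤ C ^ n * (D ^ n * k x₀) := by gcongr; exact b2.1
        _ ≤ C ^ n * (D ^ n * (C ^ n * k (g ^ n • x₀))) := by gcongr; exact a2.2
        _ ≤ C ^ n * (D ^ n * (C ^ n * (D ^ n * k (g ^ n • h ^ n • x₀)))) := by
          gcongr; exact a1.2
        _ = _ := by ring
  have hE : 0 < (C * D) * (C * D) := by positivity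
  apply le_antisymm
  · apply le_one_of_pow_bound hE
    intro n
    have := (key n).1
    rw [comm_pow H] at this
    exact le_of_mul_le_mul_right this (hpos _)
  · have : t⁻¹ ≤ 1 := by
      apply le_one_of_pow_bound hE
      intro n
      have h1 := (key n).2
      rw [comm_pow H, ← mul_assoc] at h1
      have h2 : 1 * k (h ^ n • g ^ n • x₀) ≤ _ := (one_mul _).trans_le h1
      have h3 := le_of_mul_le_mul_right h2 (hpos _)
      rw [inv_pow]
      rw [inv_le_iff_one_le_mul₀ (by positivity)]
      exact h3
    exact (inv_le_one₀ ht).1 this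

theorem abstract_km [Group.IsNilpotent G] {N : Set (X → ℝ)} {x₀ : X}
    (hN1 : ∀ k ∈ N, k x₀ = 1)
    (hN0 : ∀ k ∈ N, ∀ x, 0 ≤ k x) (hconv : Convex ℝ N)
    (hHar : ∀ x y : X, ∃ C : ℝ, 0 < C ∧ ∀ k ∈ N, ∀ h : G, k (h • y) ≤ C * k (h • x))
    (hlin : ∀ k ∈ N, ∀ g : G, ∀ α β : ℝ, (∀ x, 0 ≤ α * k x + β * k (g • x)) →
      α * k x₀ + β * k (g • x₀) = 1 → (fun x => α * k x + β * k (g • x)) ∈ N)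
    (hV : CocompactAction G X) :
    closure N ⊆ closure (convexHull ℝ
      {k | k ∈ closure N ∧ ∀ (g : G) x, k (g • x) = k (g • x₀) * k x}) := by
  have hKM := closure_convexHull_extremePoints (K_compact hN1 hN0 hHar) hconv.closure
  -- (a),(b)
  have stepb : ∀ g : G, (∀ k ∈ closure N, ∀ (h : G) x, k (g • h • x) = k (h • g • x)) →
      ∀ k ∈ (closure N).extremePoints ℝ, ∀ x, k (g • x) = k (g • x₀) * k x := by
    intro g hg k hk x
    obtain ⟨V, hV⟩ := hV
    choose C hC H using fun v => K_har hHar v (g • v)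
    have hCs : ∀ v ∈ V, C v ≤ ∑ v ∈ V, C v := fun v hv =>
      Finset.single_le_sum (f := C) (fun v _ => (hC v).le) hv
    have hCp : 0 < ∑ v ∈ V, C v := by
      obtain ⟨_, v, hv, _⟩ := hV x
      exact (hC v).trans_le (hCs v hv)
    refine ext_step hN1 hN0 hHar hlin g _ hCp ?_ hk x
    intro k hk x
    obtain ⟨h, v, hv, rfl⟩ := hV x
    rw [hg k hk]
    exact (H v k hk h).trans (mul_le_mul_of_nonneg_right (hCs v hv) (K_nonneg hN0 hk _))
  have main : ∀ i : ℕ, ∀ g ∈ Subgroup.upperCentralSeries G i,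
      ∀ k ∈ closure N, ∀ (h : G) x, k (g • h • x) = k (h • g • x) := by
    intro i
    induction i with
    | zero =>
      intro g hg k _ h x
      have : g = 1 := by simpa using hg
      simp [this]
    | succ i ih =>
      intro g hg k hk h x
      have hc : IsClosed {k : X → ℝ | k (g • h • x) = k (h • g • x)} :=
        isClosed_eq (continuous_apply _) (continuous_apply _)
      have hcv : Convex ℝ {k : X → ℝ | k (g • h • x) = k (h • g • x)} := by
        intro p hp q hq a b _ _ _
        simp only [Set.mem_ofPred_eq] at hp hq
        simp [hp, hq]
      rw [← hKM] at hk
      refine closure_minimal (convexHull_min ?_ hcv) hc hk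
      clear hk k
      intro k hk
      obtain ⟨z, hzdef, hz⟩ : ∃ z : G, z = g * h * g⁻¹ * h⁻¹ ∧
          z ∈ Subgroup.upperCentralSeries G i :=
        ⟨_, rfl, Subgroup.mem_upperCentralSeries_succ_iff.1 hg h⟩
      have hgh : ∀ x : X, g • h • x = z • h • g • x := by
        intro x
        simp only [← mul_smul, hzdef]
        congr 1
        group
      have hzk := stepb z (ih z hz) k hk
      have H : ∀ (w : G) x, k (w • g • h • x) = k (z • x₀) * k (w • h • g • x) := by
        intro w x
        rw [hgh, ← ih z hz k hk.1, hzk]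
      have ht : k (z • x₀) = 1 := by
        refine commutator_trivial (x₀ := x₀) (K_pos hN1 hHar hk.1 _) (K_pos hN1 hHar hk.1) ?_ H
        intro s
        obtain ⟨C, hC, H1⟩ := K_har hHar x₀ (s • x₀)
        obtain ⟨D, hD, H2⟩ := K_har hHar (s • x₀) x₀
        refine ⟨max C D, lt_max_of_lt_left hC, fun w => ⟨?_, ?_⟩⟩
        · exact (H1 k hk.1 w).trans
            (mul_le_mul_of_nonneg_right (le_max_left _ _) (K_nonneg hN0 hk.1 _))
        · exact (H2 k hk.1 w).trans
            (mul_le_mul_of_nonneg_right (le_max_right _ _) (K_nonneg hN0 hk.1 _))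
      have := H 1 x
      rwa [ht, one_mul, one_smul, one_smul] at this
  obtain ⟨n, hn⟩ := Group.IsNilpotent.nilpotent G
  conv_lhs => rw [← hKM]
  refine closure_mono (convexHull_mono ?_)
  intro k hk
  exact ⟨hk.1, fun g x => stepb g (main n g (by rw [hn]; trivial)) k hk x⟩

end Abstract

theorem hasSum_of_eq {X : Type*} {u v : X → ℝ} {s t : ℝ} (h : HasSum u s)
    (huv : ∀ y, v y = u y) (hst : t = s) : HasSum v t := by
  have : v = u := funext huv
  rw [this, hst]
  exact h

theorem harm_iff {X : Type*} {b : X → X → ℝ} {c : X → ℝ}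
    (hb0 : ∀ x y, 0 ≤ b x y) (hbs : ∀ x, Summable (b x)) (f : X → ℝ) :
    (InDom b f ∧ schrodinger b c f = 0) ↔
      ∀ x, HasSum (fun y => b x y * f y) (deg b c x * f x) := by
  have habs : ∀ x, (fun y => b x y * |f y|) = fun y => |b x y * f y| := by
    intro x
    funext y
    rw [abs_mul, abs_of_nonneg (hb0 x y)]
  have hval : ∀ x, Summable (fun y => b x y * f y) →
      schrodinger b c f x = deg b c x * f x - ∑' y, b x y * f y := by
    intro x hs
    simp only [schrodinger, deg, mul_sub]
    rw [((hbs x).mul_right (f x)).tsum_sub hs, tsum_mul_right]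
    ring
  constructor
  · rintro ⟨hd, h0⟩ x
    have hs : Summable (fun y => b x y * f y) := by
      have := hd x
      rw [habs] at this
      exact this.of_abs
    have h1 := hval x hs
    rw [h0] at h1
    have h2 : deg b c x * f x = ∑' y, b x y * f y := by
      simp only [Pi.zero_apply] at h1
      linarith
    rw [h2]
    exact hs.hasSum
  · intro h
    refine ⟨fun x => ?_, ?_⟩
    · rw [habs]
      exact (h x).summable.abs
    · funext x
      rw [hval x (h x).summable, (h x).tsum_eq]
      simp

theorem harnack {X : Type*} {b : X → X → ℝ} {c : X → ℝ}
    (hb0 : ∀ x y, 0 ≤ b x y) (hbs : ∀ x, Summable (b x)) (hconn : Connected b) (x y : X) :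
    ∃ C : ℝ, 0 < C ∧ ∀ f : X → ℝ, InDom b f → schrodinger b c f = 0 → (∀ x, 0 ≤ f x) →
      f y ≤ C * f x := by
  induction hconn x y with
  | refl => exact ⟨1, one_pos, fun f _ _ _ => by simp⟩
  | @tail u v _ huv ih =>
    obtain ⟨C, hC, H⟩ := ih
    refine ⟨(|deg b c u| / b u v + 1) * C, by positivity, fun f h1 h2 h3 => ?_⟩
    have hs := (harm_iff hb0 hbs f).1 ⟨h1, h2⟩ u
    have h4 : b u v * f v ≤ deg b c u * f u :=
      le_hasSum hs v fun z _ => mul_nonneg (hb0 u z) (h3 z)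
    have h5 := H f h1 h2 h3
    have h6 : f v ≤ |deg b c u| / b u v * f u := by
      rw [div_mul_eq_mul_div, le_div_iff₀ huv, mul_comm (f v)]
      exact h4.trans (mul_le_mul_of_nonneg_right (le_abs_self _) (h3 u))
    have h7 : 0 ≤ |deg b c u| / b u v + 1 := by positivity
    calc f v ≤ (|deg b c u| / b u v + 1) * f u := by linarith [h3 u]
      _ ≤ (|deg b c u| / b u v + 1) * (C * f x) := by gcongr
      _ = _ := by ring

theorem ae_harm {X : Type*} [Countable X] {b : X → X → ℝ} {c : X → ℝ}
    (hb0 : ∀ x y, 0 ≤ b x y) {p : X → ℝ}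
    (hp : ∀ x, HasSum (fun y => b x y * p y) (deg b c x * p x))
    (μ : Measure (X → ℝ))
    (hK : ∀ᵐ k ∂μ, (∀ x, 0 ≤ k x) ∧
      ∀ x (s : Finset X), ∑ y ∈ s, b x y * k y ≤ deg b c x * k x)
    (hr : ∀ x, Integrable (fun k : X → ℝ => k x) μ ∧ p x = ∫ k, k x ∂μ) (x : X) :
    ∀ᵐ k ∂μ, HasSum (fun y => b x y * k y) (deg b c x * k x) := by
  have hint : ∀ y, Integrable (fun k : X → ℝ => b x y * k y) μ := fun y => (hr y).1.const_mul _
  have hnorm : ∀ y, ∫ k, ‖b x y * k y‖ ∂μ = b x y * p y := by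
    intro y
    rw [(hr y).2, ← integral_const_mul]
    apply integral_congr_ae
    filter_upwards [hK] with k hk
    rw [Real.norm_of_nonneg (mul_nonneg (hb0 x y) (hk.1 y))]
  have hsum : Summable fun y => ∫ k, ‖b x y * k y‖ ∂μ := by
    simp only [hnorm]
    exact (hp x).summable
  have h1 := hasSum_integral_of_summable_integral_norm hint hsum
  have h2 : ∫ k, (∑' y, b x y * k y) ∂μ = deg b c x * p x := by
    refine h1.unique ?_
    refine hasSum_of_eq (hp x) (fun y => ?_) rfl
    rw [integral_const_mul, (hr y).2]
  have hsm : ∀ᵐ k ∂μ, Summable fun y => b x y * k y := by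
    filter_upwards [hK] with k hk
    exact summable_of_sum_le (fun y => mul_nonneg (hb0 x y) (hk.1 y)) (hk.2 x)
  have hle : ∀ᵐ k ∂μ, (∑' y, b x y * k y) ≤ deg b c x * k x := by
    filter_upwards [hK, hsm] with k hk hs
    exact hs.tsum_le_of_sum_le (hk.2 x)
  have hi2 : Integrable (fun k : X → ℝ => deg b c x * k x) μ := (hr x).1.const_mul _
  have hi1 : Integrable (fun k : X → ℝ => ∑' y, b x y * k y) μ := by
    refine hi2.mono' ?_ ?_
    · exact (Measurable.tsum (fun y => (measurable_pi_apply y).const_mul _)).aestronglyMeasurable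
    · filter_upwards [hK, hle] with k hk hl
      rwa [Real.norm_of_nonneg (tsum_nonneg fun y => mul_nonneg (hb0 x y) (hk.1 y))]
  have heq : (fun k : X → ℝ => ∑' y, b x y * k y) =ᵐ[μ] fun k => deg b c x * k x := by
    refine (integral_eq_iff_of_ae_le hi1 hi2 hle).1 ?_
    rw [h2, integral_const_mul, (hr x).2]
  filter_upwards [heq, hsm] with k hk hs
  rw [← hk]
  exact hs.hasSum

/-- Choquet representation of positive harmonic functions over the
harmonic multiplicative elements of `𝓚`. -/
theorem choquet_representation {X : Type*} [Countable X] {G : Type*} [Group G]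
    [MulAction G X] [Group.IsNilpotent G]
    (b : X → X → ℝ) (c : X → ℝ)
    (hb0 : ∀ x y, 0 ≤ b x y) (hbd : ∀ x, b x x = 0) (hbs : ∀ x, Summable (b x))
    (hconn : Connected b) (hcocpt : CocompactAction G X)
    (hH : HInvOn b c (Set.univ : Set G)) (x₀ : X)
    (f : X → ℝ) (hf : f ∈ Hplus b c) :
    ∃ μ : Measure (X → ℝ), IsProbabilityMeasure μ ∧
      μ {k | ¬ (k ∈ Kset b c x₀ ∧ InDom b k ∧ schrodinger b c k = 0 ∧
        IsMultiplicative G k)} = 0 ∧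
      ∀ x : X, f x = f x₀ * ∫ k, k x ∂μ := by
  set N : Set (X → ℝ) := {f : X → ℝ | f ∈ Hplus b c ∧ f x₀ = 1} with hNdef
  have hNmk : ∀ k : X → ℝ, (∀ x, HasSum (fun y => b x y * k y) (deg b c x * k x)) →
      (∀ x, 0 ≤ k x) → k x₀ = 1 → k ∈ N := by
    intro k h1 h2 h3
    obtain ⟨h4, h5⟩ := (harm_iff hb0 hbs k).2 h1
    refine ⟨⟨h4, h5, h2, ?_⟩, h3⟩
    rintro rfl
    simp at h3
  have hNh : ∀ k ∈ N, ∀ x, HasSum (fun y => b x y * k y) (deg b c x * k x) :=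
    fun k hk => (harm_iff hb0 hbs k).1 ⟨hk.1.1, hk.1.2.1⟩
  have hN1 : ∀ k ∈ N, k x₀ = 1 := fun k hk => hk.2
  have hN0 : ∀ k ∈ N, ∀ x, 0 ≤ k x := fun k hk => hk.1.2.2.1
  have hshift : ∀ k : X → ℝ, InDom b k → schrodinger b c k = 0 → ∀ g : G,
      InDom b (fun x => k (g • x)) ∧ schrodinger b c (fun x => k (g • x)) = 0 := by
    intro k h1 h2 g
    have h3 := hH g⁻¹ (Set.mem_univ _) k h1
    have h4 : shift g⁻¹ k = fun x => k (g • x) := by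
      funext x
      simp [shift]
    rw [h4, h2] at h3
    refine ⟨h3.1, h3.2.trans ?_⟩
    funext x
    simp [shift]
  have hHar : ∀ x y : X, ∃ C : ℝ, 0 < C ∧ ∀ k ∈ N, ∀ h : G,
      k (h • y) ≤ C * k (h • x) := by
    intro x y
    obtain ⟨C, hC, H⟩ := harnack (c := c) hb0 hbs hconn x y
    refine ⟨C, hC, fun k hk h => ?_⟩
    obtain ⟨h1, h2⟩ := hshift k hk.1.1 hk.1.2.1 h
    exact H (fun x => k (h • x)) h1 h2 fun x => hN0 k hk _
  have hconv : Convex ℝ N := by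
    intro p hp q hq s t hs ht hst
    apply hNmk
    · intro x
      refine hasSum_of_eq (((hNh p hp x).mul_left s).add ((hNh q hq x).mul_left t)) (fun y => ?_) ?_
      · simp only [Pi.add_apply, Pi.smul_apply, smul_eq_mul]
        ring
      · simp only [Pi.add_apply, Pi.smul_apply, smul_eq_mul]
        ring
    · intro x
      have h1 := hN0 p hp x
      have h2 := hN0 q hq x
      simp only [Pi.add_apply, Pi.smul_apply, smul_eq_mul]
      positivity
    · simp [hN1 p hp, hN1 q hq, hst]
  have hlin : ∀ k ∈ N, ∀ g : G, ∀ α β : ℝ, (∀ x, 0 ≤ α * k x + β * k (g • x)) →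
      α * k x₀ + β * k (g • x₀) = 1 → (fun x => α * k x + β * k (g • x)) ∈ N := by
    intro k hk g α β h0 h1
    refine hNmk _ (fun x => ?_) h0 h1
    have h2 := (harm_iff hb0 hbs _).1 (hshift k hk.1.1 hk.1.2.1 g) x
    refine hasSum_of_eq (((hNh k hk x).mul_left α).add (h2.mul_left β)) (fun y => ?_) ?_
    · ring
    · ring
  have hkm := abstract_km (G := G) hN1 hN0 hconv hHar hlin hcocpt
  obtain ⟨hf1, hf2, hf3, hf4⟩ := hf
  have hfx : 0 < f x₀ := by
    by_contra h
    apply hf4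
    funext y
    obtain ⟨C, hC, H⟩ := harnack (c := c) hb0 hbs hconn x₀ y
    have h1 := H f hf1 hf2 hf3
    have h2 : C * f x₀ ≤ 0 := mul_nonpos_of_nonneg_of_nonpos hC.le (not_lt.mp h)
    exact le_antisymm (h1.trans h2) (hf3 y)
  have hph : ∀ x, HasSum (fun y => b x y * ((f x₀)⁻¹ * f y)) (deg b c x * ((f x₀)⁻¹ * f x)) := by
    intro x
    refine hasSum_of_eq (((harm_iff hb0 hbs f).1 ⟨hf1, hf2⟩ x).mul_left (f x₀)⁻¹) (fun y => ?_) ?_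
    · ring
    · ring
  have hpN : (fun x => (f x₀)⁻¹ * f x) ∈ N :=
    hNmk _ hph (fun x => mul_nonneg (inv_nonneg.2 hfx.le) (hf3 x)) (inv_mul_cancel₀ hfx.ne')
  have hMc : IsCompact
      {k | k ∈ closure N ∧ ∀ (g : G) x, k (g • x) = k (g • x₀) * k x} := by
    refine (K_compact hN1 hN0 hHar).inter_right (t := {k | ∀ (g : G) x, k (g • x) = k (g • x₀) * k x}) ?_
    simp only [Set.ofPred_forall]
    exact isClosed_iInter fun g => isClosed_iInter fun x =>
      isClosed_eq (continuous_apply _) ((continuous_apply (g • x₀)).mul (continuous_apply x))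
  obtain ⟨μ, hμ, hμM, hr⟩ := exists_rep hMc (hkm (subset_closure hpN))
  refine ⟨μ, hμ, ?_, fun x => ?_⟩
  · have hKa : ∀ᵐ k ∂μ, (∀ x, 0 ≤ k x) ∧
        ∀ x (s : Finset X), ∑ y ∈ s, b x y * k y ≤ deg b c x * k x := by
      filter_upwards [hμM] with k hk
      refine ⟨K_nonneg hN0 hk.1, fun x s => ?_⟩
      have hc : IsClosed {k : X → ℝ | ∑ y ∈ s, b x y * k y ≤ deg b c x * k x} :=
        isClosed_le (continuous_finsetSum _ fun y _ =>
          continuous_const.mul (continuous_apply y))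
          (continuous_const.mul (continuous_apply x))
      refine closure_minimal (s := N) (fun k hk => ?_) hc hk.1
      exact sum_le_hasSum s (fun y _ => mul_nonneg (hb0 x y) (hN0 k hk y)) (hNh k hk x)
    have hah := ae_all_iff.2 (ae_harm hb0 hph μ hKa hr)
    have : ∀ᵐ k ∂μ, k ∈ Kset b c x₀ ∧ InDom b k ∧ schrodinger b c k = 0 ∧
        IsMultiplicative G k := by
      filter_upwards [hah, hμM] with k hk hkM
      obtain ⟨h1, h2⟩ := (harm_iff hb0 hbs k).2 hk
      refine ⟨hkM.1, h1, h2, ?_⟩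
      refine ⟨⟨⟨fun g => k (g • x₀), ?_⟩, ?_⟩, fun g => K_pos hN1 hHar hkM.1 _, fun g => ?_⟩
      · simpa using K_val hN1 hkM.1
      · intro g h
        simp only [mul_smul]
        exact hkM.2 g _
      · funext x
        exact hkM.2 g⁻¹ x
    exact this
  · rw [← (hr x).2]
    field_simp

end GraphPaper
end
end

section
/- Let (b,c) be a locally finite, connected graph over X, and let G be a nilpotent group acting cocompactly on X such that H_{b,c} is G-invariant; fix x₀ ∈ X. Then 𝓜 = ex 𝓚, i.e. the set of G-multiplicative elements of 𝓚 equals the set of extreme points of the convex compact set 𝓚. -/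
open MeasureTheory
open scoped BigOperators

noncomputable section

namespace GraphPaper

variable {X : Type*}

variable {G : Type*} [Group G] [MulAction G X]

section Aux

lemma max_principle {b : X → X → ℝ} {N : X → Finset X}
    (hN : ∀ x y, y ∈ N x ↔ 0 < b x y) (hconn : Connected b) {D : X → ℝ} {s : ℝ}
    (hD : ∀ x, ∑ y ∈ N x, b x y * (D x - D y) = 0) (hs : ∀ x, D x ≤ s)
    {v : X} (hv : D v = s) (x : X) : D x = s := by
  induction hconn v x with
  | refl => exact hv
  | @tail p q _ hpq ih =>
    have h0 := hD p
    have hnn : ∀ y ∈ N p, 0 ≤ b p y * (D p - D y) := by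
      intro y hy
      have h1 := (hN p y).1 hy
      have h2 := hs y
      exact mul_nonneg h1.le (by linarith)
    have h3 := (Finset.sum_eq_zero_iff_of_nonneg hnn).1 h0 q ((hN p q).2 hpq)
    rcases mul_eq_zero.1 h3 with h | h
    · exact absurd h hpq.ne'
    · linarith

lemma harm_shift {b : X → X → ℝ} {N : X → Finset X}
    (hN : ∀ x y, y ∈ N x ↔ 0 < b x y)
    (hinv : ∀ (g : G) x y, b (g • x) (g • y) = b x y) {h : X → ℝ}
    (hh : ∀ x, ∑ y ∈ N x, b x y * (h x - h y) = 0) (w : G) (x : X) :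
    ∑ y ∈ N x, b x y * (h (w • x) - h (w • y)) = 0 := by
  rw [← hh (w • x)]
  refine Finset.sum_nbij' (fun y => w • y) (fun y => w⁻¹ • y) ?_ ?_ ?_ ?_ ?_
  · intro y hy
    rw [hN, hinv]
    exact (hN _ _).1 hy
  · intro y hy
    rw [hN, ← hinv w, smul_inv_smul]
    exact (hN _ _).1 hy
  · intro y _
    simp
  · intro y _
    simp
  · intro y _
    rw [hinv]

lemma liouville_step {b : X → X → ℝ} {N : X → Finset X}
    (hN : ∀ x y, y ∈ N x ↔ 0 < b x y) (hconn : Connected b)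
    (hinv : ∀ (g : G) x y, b (g • x) (g • y) = b x y) (hco : CocompactAction G X)
    (C : ℝ) (g : G)
    (hcomm : ∀ h : X → ℝ, (∀ x, ∑ y ∈ N x, b x y * (h x - h y) = 0) → (∀ x, |h x| ≤ C) →
      ∀ (w : G) x, h (g • w • x) = h (w • g • x))
    (h : X → ℝ) (hh : ∀ x, ∑ y ∈ N x, b x y * (h x - h y) = 0) (hC : ∀ x, |h x| ≤ C) (x : X) :
    h (g • x) ≤ h x := by
  obtain ⟨V, hV⟩ := hco
  set B : Set (X → ℝ) := {h | (∀ x, ∑ y ∈ N x, b x y * (h x - h y) = 0) ∧ ∀ x, |h x| ≤ C}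
    with hB
  have hBc : IsCompact B := by
    have h1 : IsCompact (Set.univ.pi fun _ : X => Set.Icc (-C) C) :=
      isCompact_univ_pi fun _ => isCompact_Icc
    refine h1.of_isClosed_subset ?_ ?_
    · rw [hB, Set.ofPred_and, Set.ofPred_forall, Set.ofPred_forall]
      refine IsClosed.inter ?_ ?_
      · refine isClosed_iInter fun x => isClosed_eq ?_ continuous_const
        fun_prop
      · refine isClosed_iInter fun x => isClosed_le ?_ continuous_const
        fun_prop
    · intro k hk x _
      exact abs_le.1 (hk.2 x)
  have hVne : V.Nonempty := by
    obtain ⟨_, v, hv, _⟩ := hV x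
    exact ⟨v, hv⟩
  have hBne : B.Nonempty := ⟨h, hh, hC⟩
  have key : ∀ v : X, ∃ k ∈ B, ∀ l ∈ B, l (g • v) - l v ≤ k (g • v) - k v := by
    intro v
    obtain ⟨k, hk, hk'⟩ := hBc.exists_isMaxOn hBne
      (f := fun l : X → ℝ => l (g • v) - l v) (by fun_prop)
    exact ⟨k, hk, fun l hl => hk' hl⟩
  choose k hkB hk using key
  obtain ⟨v, hvV, hv⟩ := V.exists_max_image (fun v => k v (g • v) - k v v) hVne
  set s := k v (g • v) - k v v with hs
  have hle : ∀ l ∈ B, ∀ x, l (g • x) - l x ≤ s := by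
    intro l hl x
    obtain ⟨w, u, hu, rfl⟩ := hV x
    rw [hcomm l hl.1 hl.2]
    have hl' : (fun x => l (w • x)) ∈ B :=
      ⟨fun x => harm_shift hN hinv hl.1 w x, fun x => hl.2 _⟩
    exact (hk u _ hl').trans (hv u hu)
  have hconst : ∀ x, k v (g • x) - k v x = s := by
    intro x
    refine max_principle (D := fun x => k v (g • x) - k v x) hN hconn ?_ (hle _ (hkB v)) hs.symm x
    intro x
    have h1 := harm_shift hN hinv (hkB v).1 g x
    have h2 := (hkB v).1 x
    rw [← sub_eq_zero.2 (h1.trans h2.symm), ← Finset.sum_sub_distrib]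
    exact Finset.sum_congr rfl fun y _ => by ring
  have hpow : ∀ n : ℕ, k v (g ^ n • v) = k v v + n * s := by
    intro n
    induction n with
    | zero => simp
    | succ n ih =>
      have := hconst (g ^ n • v)
      rw [pow_succ', mul_smul]
      push_cast
      linarith
  have hs0 : s ≤ 0 := by
    by_contra hpos
    push Not at hpos
    obtain ⟨n, hn⟩ := exists_nat_gt (2 * C / s)
    rw [div_lt_iff₀ hpos] at hn
    have h1 := abs_le.1 ((hkB v).2 v)
    have h2 := abs_le.1 ((hkB v).2 (g ^ n • v))
    have := hpow n
    linarith
  have := hle h ⟨hh, hC⟩ x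
  linarith

lemma liouville [Group.IsNilpotent G] {b : X → X → ℝ} {N : X → Finset X}
    (hN : ∀ x y, y ∈ N x ↔ 0 < b x y) (hconn : Connected b)
    (hinv : ∀ (g : G) x y, b (g • x) (g • y) = b x y) (hco : CocompactAction G X)
    (C : ℝ)
    (h : X → ℝ) (hh : ∀ x, ∑ y ∈ N x, b x y * (h x - h y) = 0) (hC : ∀ x, |h x| ≤ C) (x y : X) :
    h x = h y := by
  have main : ∀ n : ℕ, ∀ g ∈ Subgroup.upperCentralSeries G n, ∀ h : X → ℝ,
      (∀ x, ∑ y ∈ N x, b x y * (h x - h y) = 0) → (∀ x, |h x| ≤ C) →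
      ∀ x, h (g • x) = h x := by
    intro n
    induction n with
    | zero =>
      intro g hg h _ _ x
      have : g = 1 := by simpa using hg
      simp [this]
    | succ n ih =>
      have hle : ∀ g ∈ Subgroup.upperCentralSeries G (n + 1), ∀ h : X → ℝ,
          (∀ x, ∑ y ∈ N x, b x y * (h x - h y) = 0) → (∀ x, |h x| ≤ C) →
          ∀ x, h (g • x) ≤ h x := by
        intro g hg h hh hC x
        refine liouville_step hN hconn hinv hco C g ?_ h hh hC x
        intro l hl hlC w z
        have h1 := ih _ (Subgroup.mem_upperCentralSeries_succ_iff.1 hg w) l hl hlC (w • g • z)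
        rw [← h1]
        simp [← mul_smul, mul_assoc, commutatorElement_def]
      intro g hg h hh hC x
      refine le_antisymm (hle g hg h hh hC x) ?_
      have := hle g⁻¹ (inv_mem hg) h hh hC (g • x)
      simpa using this
  obtain ⟨n, hn⟩ := Group.IsNilpotent.nilpotent (G := G)
  have hG : ∀ (g : G) x, h (g • x) = h x := fun g x =>
    main n g (by rw [hn]; trivial) h hh hC x
  obtain ⟨V, hV⟩ := hco
  have hVne : V.Nonempty := by
    obtain ⟨_, v, hv, _⟩ := hV x
    exact ⟨v, hv⟩
  obtain ⟨v, _, hv⟩ := V.exists_max_image h hVne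
  have hle : ∀ x, h x ≤ h v := by
    intro x
    obtain ⟨w, u, hu, rfl⟩ := hV x
    rw [hG]
    exact hv u hu
  rw [max_principle hN hconn hh hle rfl x, max_principle hN hconn hh hle rfl y]

lemma harnack_s12 {b : X → X → ℝ} {D : X → ℝ} {N : X → Finset X}
    (hN : ∀ x y, y ∈ N x ↔ 0 < b x y) (hconn : Connected b) (x y : X) :
    ∃ C > 0, ∀ f : X → ℝ, (∀ x, ∑ y ∈ N x, b x y * f y = D x * f x) → (∀ x, 0 ≤ f x) →
      f y ≤ C * f x := by
  induction hconn x y with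
  | refl => exact ⟨1, one_pos, fun f _ _ => by simp⟩
  | @tail p q _ hpq ih =>
    obtain ⟨C, hC, h⟩ := ih
    refine ⟨(|D p| / b p q + 1) * C, by positivity, fun f hf hf0 => ?_⟩
    have h1 : b p q * f q ≤ D p * f p := by
      rw [← hf p]
      exact Finset.single_le_sum (f := fun y => b p y * f y)
        (fun y hy => mul_nonneg ((hN p y).1 hy).le (hf0 y)) ((hN p q).2 hpq)
    have h2 : D p * f p ≤ |D p| * f p := mul_le_mul_of_nonneg_right (le_abs_self _) (hf0 p)
    have h3 : f q ≤ |D p| / b p q * f p := by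
      rw [div_mul_eq_mul_div, le_div_iff₀ hpq]
      linarith
    have h4 := h f hf hf0
    have h5 := hf0 p
    calc f q ≤ (|D p| / b p q + 1) * f p := by linarith
      _ ≤ (|D p| / b p q + 1) * (C * f x) := by gcongr
      _ = _ := by ring

lemma growth {f : X → ℝ} (hpos : ∀ x, 0 < f x)
    (hhar : ∀ x y, ∃ C > 0, ∀ w : G, f (w • y) ≤ C * f (w • x))
    {g h : G} {a : ℝ} (ha : 0 < a)
    (hgh : ∀ (w : G) x, f (w • g • h • x) = a * f (w • h • g • x)) (v : X) : a ≤ 1 := by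
  have hstep : ∀ (n : ℕ) (w : G) x, f (w • g ^ n • h • x) = a ^ n * f (w • h • g ^ n • x) := by
    intro n
    induction n with
    | zero => intro w x; simp
    | succ n ih =>
      intro w x
      have h1 := hgh (w * g ^ n) x
      have h2 := ih w (g • x)
      simp only [pow_succ, mul_smul] at h1 h2 ⊢
      rw [h1, h2]
      ring
  have hstep2 : ∀ (n m : ℕ) (w : G) x,
      f (w • g ^ n • h ^ m • x) = (a ^ n) ^ m * f (w • h ^ m • g ^ n • x) := by
    intro n m
    induction m with
    | zero => intro w x; simp
    | succ m ih =>
      intro w x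
      have h1 := ih w (h • x)
      have h2 := hstep n (w * h ^ m) x
      rw [pow_succ h, mul_smul, h1]
      simp only [mul_smul] at h2 ⊢
      rw [h2]
      ring
  have hp : ∀ k : G, ∃ C > 0, ∀ (n : ℕ) (w : G), f (w • k ^ n • v) ≤ C ^ n * f (w • v) := by
    intro k
    obtain ⟨C, hC, hCk⟩ := hhar v (k • v)
    refine ⟨C, hC, fun n => ?_⟩
    induction n with
    | zero => intro w; simp
    | succ n ih =>
      intro w
      have h1 := hCk (w * k ^ n)
      have h2 := ih w
      simp only [pow_succ, mul_smul] at h1 ⊢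
      calc _ ≤ _ := h1
        _ ≤ C * (C ^ n * f (w • v)) := by gcongr
        _ = _ := by ring
  obtain ⟨C1, hC1, h1⟩ := hp g
  obtain ⟨C2, hC2, h2⟩ := hp h
  obtain ⟨C3, hC3, h3⟩ := hp g⁻¹
  obtain ⟨C4, hC4, h4⟩ := hp h⁻¹
  have hall : ∀ n : ℕ, (a ^ n) ^ n ≤ (C4 * C3 * C2 * C1) ^ n := by
    intro n
    have e := hstep2 n n 1 v
    have e1 := h1 n 1
    have e2 := h2 n (g ^ n)
    have e3 := h3 n (h ^ n * g ^ n)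
    have e4 := h4 n (h ^ n)
    simp only [one_smul, mul_smul, inv_pow, smul_inv_smul] at e e1 e2 e3 e4
    have hv := hpos v
    have hlow : f v ≤ C4 ^ n * (C3 ^ n * f (h ^ n • g ^ n • v)) :=
      e4.trans (by gcongr)
    have hup : (a ^ n) ^ n * f (h ^ n • g ^ n • v) ≤ C2 ^ n * (C1 ^ n * f v) := by
      rw [← e]
      exact e2.trans (by gcongr)
    have : (a ^ n) ^ n * f v ≤ (C4 * C3 * C2 * C1) ^ n * f v := by
      calc (a ^ n) ^ n * f v ≤ (a ^ n) ^ n * (C4 ^ n * (C3 ^ n * f (h ^ n • g ^ n • v))) := by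
            gcongr
        _ = C4 ^ n * C3 ^ n * ((a ^ n) ^ n * f (h ^ n • g ^ n • v)) := by ring
        _ ≤ C4 ^ n * C3 ^ n * (C2 ^ n * (C1 ^ n * f v)) := by gcongr
        _ = _ := by simp only [mul_pow]; ring
    exact le_of_mul_le_mul_right this hv
  by_contra hlt
  push Not at hlt
  obtain ⟨n, hn⟩ := pow_unbounded_of_one_lt (C4 * C3 * C2 * C1) hlt
  have hn0 : n + 1 ≠ 0 := by omega
  have h5 := hall (n + 1)
  have h6 := (pow_le_pow_iff_left₀ (by positivity) (by positivity) hn0).1 h5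
  have h7 : a ^ n ≤ a ^ (n + 1) := pow_le_pow_right₀ hlt.le (by omega)
  linarith

lemma multiplicative_of_extreme [Group.IsNilpotent G] {f : X → ℝ} (hpos : ∀ x, 0 < f x)
    (hhar : ∀ x y, ∃ C > 0, ∀ w : G, f (w • y) ≤ C * f (w • x))
    (hco : CocompactAction G X)
    (hext : ∀ (g : G) (C : ℝ), (∀ x, f (g • x) ≤ C * f x) → ∃ a > 0, ∀ x, f (g • x) = a * f x)
    (g : G) (v : X) : ∃ a > 0, ∀ x, f (g • x) = a * f x := by
  have main : ∀ n : ℕ, ∀ g ∈ Subgroup.upperCentralSeries G n,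
      ∃ a > 0, ∀ (w : G) x, f (w • g • x) = a * f (w • x) := by
    intro n
    induction n with
    | zero =>
      intro g hg
      have : g = 1 := by simpa using hg
      exact ⟨1, one_pos, by simp [this]⟩
    | succ n ih =>
      intro g hg
      have hcomm : ∀ (h w : G) x, f (w • g • h • x) = f (w • h • g • x) := by
        intro h
        obtain ⟨a, ha, hk⟩ := ih _ (Subgroup.mem_upperCentralSeries_succ_iff.1 hg h)
        have e1 : ∀ (w : G) x, f (w • g • h • x) = a * f (w • h • g • x) := by
          intro w x
          rw [← hk w (h • g • x)]
          simp [← mul_smul, mul_assoc, commutatorElement_def]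
        have e2 : ∀ (w : G) x, f (w • h • g • x) = a⁻¹ * f (w • g • h • x) := by
          intro w x
          rw [e1, inv_mul_cancel_left₀ ha.ne']
        have l1 := growth hpos hhar ha e1 v
        have l2 := growth hpos hhar (inv_pos.2 ha) e2 v
        have l3 : 1 ≤ a := by
          rwa [inv_le_one₀ ha] at l2
        have : a = 1 := le_antisymm l1 l3
        intro w x
        rw [e1, this, one_mul]
      have hb : ∃ C, ∀ x, f (g • x) ≤ C * f x := by
        obtain ⟨V, hV⟩ := hco
        choose Cf hC0 hCf using fun v : X => hhar v (g • v)
        refine ⟨∑ v ∈ V, Cf v, fun x => ?_⟩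
        obtain ⟨w, u, hu, rfl⟩ := hV x
        have e := hcomm w 1 u
        simp only [one_smul] at e
        rw [e]
        refine (hCf u w).trans ?_
        have h1 : Cf u ≤ ∑ v ∈ V, Cf v := Finset.single_le_sum (fun v _ => (hC0 v).le) hu
        exact mul_le_mul_of_nonneg_right h1 (hpos _).le
      obtain ⟨C, hC⟩ := hb
      obtain ⟨a, ha, hfa⟩ := hext g C hC
      refine ⟨a, ha, fun w x => ?_⟩
      have e := hcomm w 1 x
      simp only [one_smul] at e
      rw [← e, hfa]
  obtain ⟨n, hn⟩ := Group.IsNilpotent.nilpotent (G := G)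
  obtain ⟨a, ha, h⟩ := main n g (by rw [hn]; trivial)
  exact ⟨a, ha, fun x => by simpa using h 1 x⟩

end Aux

/-- For locally finite graphs, `𝓜 = ex 𝓚`. -/
theorem Mset_eq_extremePoints {X : Type*} [Countable X] {G : Type*} [Group G]
    [MulAction G X] [Group.IsNilpotent G]
    (b : X → X → ℝ) (c : X → ℝ)
    (hb0 : ∀ x y, 0 ≤ b x y) (hbd : ∀ x, b x x = 0) (hbs : ∀ x, Summable (b x))
    (hlf : ∀ x : X, {y | 0 < b x y}.Finite) (hconn : Connected b)
    (hcocpt : CocompactAction G X)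
    (hH : HInvOn b c (Set.univ : Set G)) (x₀ : X) :
    Mset G b c x₀ = Set.extremePoints ℝ (Kset b c x₀) := by
  classical
  set N : X → Finset X := fun x => (hlf x).toFinset with hNdef
  have hN : ∀ x y, y ∈ N x ↔ 0 < b x y := by
    intro x y
    simp [hNdef]
  have hbz : ∀ x y, y ∉ N x → b x y = 0 := by
    intro x y hy
    rw [hN, not_lt] at hy
    exact le_antisymm hy (hb0 x y)
  set D : X → ℝ := fun x => (∑ y ∈ N x, b x y) + c x with hDdef
  have hdom : ∀ f : X → ℝ, InDom b f := by
    intro f x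
    refine summable_of_ne_finset_zero (s := N x) fun y hy => ?_
    rw [hbz x y hy, zero_mul]
  have hsch : ∀ (f : X → ℝ) x,
      schrodinger b c f x = D x * f x - ∑ y ∈ N x, b x y * f y := by
    intro f x
    simp only [schrodinger, hDdef]
    rw [tsum_eq_sum (s := N x) (fun y hy => by rw [hbz x y hy, zero_mul])]
    simp only [mul_sub, Finset.sum_sub_distrib, ← Finset.sum_mul]
    ring
  have hharm : ∀ f : X → ℝ, schrodinger b c f = 0 ↔ ∀ x, ∑ y ∈ N x, b x y * f y = D x * f x := by
    intro f
    constructor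
    · intro h x
      have := hsch f x
      rw [h] at this
      simp only [Pi.zero_apply] at this
      linarith
    · intro h
      funext x
      rw [hsch, h x]
      simp
  have hinv : ∀ (g : G) x y, b (g • x) (g • y) = b x y := by
    intro g x y
    by_cases hxy : x = y
    · rw [hxy, hbd, hbd]
    have hs : ∀ u v : X, u ≠ v → schrodinger b c (Pi.single v 1) u = - b u v := by
      intro u v huv
      rw [hsch]
      by_cases hv : v ∈ N u
      · simp [Pi.single_apply, huv, hv]
      · simp [Pi.single_apply, huv, hv, hbz u v hv]
    have e := congrFun (hH g (Set.mem_univ _) (Pi.single y 1) (hdom _)).2 (g • x)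
    have e2 : shift g (Pi.single y (1 : ℝ)) = Pi.single (g • y) (1 : ℝ) := by
      funext z
      simp only [shift, Pi.single_apply, inv_smul_eq_iff]
    rw [e2, hs _ _ (by simpa using hxy)] at e
    simp only [shift, inv_smul_smul] at e
    rw [hs _ _ hxy] at e
    linarith
  have hshift : ∀ (g : G) (f : X → ℝ), (∀ x, ∑ y ∈ N x, b x y * f y = D x * f x) →
      ∀ x, ∑ y ∈ N x, b x y * f (g • y) = D x * f (g • x) := by
    intro g f hf
    have e := (hH g⁻¹ (Set.mem_univ _) f (hdom _)).2
    rw [(hharm f).2 hf] at e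
    have e' : schrodinger b c (shift g⁻¹ f) = 0 := by
      rw [e]; rfl
    have := (hharm _).1 e'
    simpa [shift] using this
  have hK : ∀ f, f ∈ Kset b c x₀ ↔
      (∀ x, ∑ y ∈ N x, b x y * f y = D x * f x) ∧ (∀ x, 0 ≤ f x) ∧ f x₀ = 1 := by
    have hset : {f : X → ℝ | f ∈ Hplus b c ∧ f x₀ = 1} =
        {f | (∀ x, ∑ y ∈ N x, b x y * f y = D x * f x) ∧ (∀ x, 0 ≤ f x) ∧ f x₀ = 1} := by
      ext f
      constructor
      · rintro ⟨⟨_, h1, h2, _⟩, h3⟩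
        exact ⟨(hharm f).1 h1, h2, h3⟩
      · rintro ⟨h1, h2, h3⟩
        refine ⟨⟨hdom f, (hharm f).2 h1, h2, ?_⟩, h3⟩
        rintro rfl
        simp at h3
    have hcl : IsClosed
        {f : X → ℝ | (∀ x, ∑ y ∈ N x, b x y * f y = D x * f x) ∧ (∀ x, 0 ≤ f x) ∧ f x₀ = 1} := by
      simp only [Set.ofPred_and, Set.ofPred_forall]
      refine IsClosed.inter ?_ (IsClosed.inter ?_ ?_)
      · refine isClosed_iInter fun x => isClosed_eq ?_ ?_ <;> fun_prop
      · refine isClosed_iInter fun x => isClosed_le ?_ ?_ <;> fun_prop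
      · refine isClosed_eq ?_ ?_ <;> fun_prop
    intro f
    rw [Kset, hset, hcl.closure_eq]
    rfl
  have hposK : ∀ f ∈ Kset b c x₀, ∀ x, 0 < f x := by
    intro f hf x
    obtain ⟨h1, h2, h3⟩ := (hK f).1 hf
    obtain ⟨C, hC, h⟩ := harnack_s12 (D := D) hN hconn x x₀
    have h4 := h f h1 h2
    rw [h3] at h4
    exact pos_of_mul_pos_right (lt_of_lt_of_le one_pos h4) hC.le
  apply Set.Subset.antisymm
  · rintro f ⟨hfK, γ, hγ, hfγ⟩
    have hpos := hposK f hfK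
    have hf := (hK f).1 hfK
    have hmul : ∀ (g : G) x, f (g • x) = γ g * f x := by
      intro g x
      have := congrFun (hfγ g⁻¹) x
      simpa [shift] using this
    rw [mem_extremePoints_iff_left]
    refine ⟨hfK, ?_⟩
    rintro u huK v hvK ⟨s, t, hs, ht, hst, hsum⟩
    have hu := (hK u).1 huK
    have hv := (hK v).1 hvK
    have hle : ∀ x, s * u x ≤ f x := by
      intro x
      have := congrFun hsum x
      simp only [Pi.add_apply, Pi.smul_apply, smul_eq_mul] at this
      have := mul_nonneg ht.le (hv.2.1 x)
      linarith
    have hconst := liouville (G := G) (b := fun x y => b x y * (f y / f x)) (N := N)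
      (fun x y => by
        rw [hN, mul_pos_iff_of_pos_right (div_pos (hpos y) (hpos x))])
      (fun x y => Relation.ReflTransGen.mono
        (fun p q hpq => mul_pos hpq (div_pos (hpos q) (hpos p))) _ _ (hconn x y))
      (fun g x y => by
        simp only [hinv, hmul]
        rw [mul_div_mul_left _ _ (hγ g).ne'])
      hcocpt (1 / s) (fun x => u x / f x)
      (fun x => by
        have hx := (hpos x).ne'
        have e : ∀ y ∈ N x, b x y * (f y / f x) * (u x / f x - u y / f y) =
            (b x y * f y) * (u x / (f x * f x)) - (b x y * u y) * (1 / f x) := by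
          intro y _
          have hy := (hpos y).ne'
          field_simp
        rw [Finset.sum_congr rfl e, Finset.sum_sub_distrib, ← Finset.sum_mul, ← Finset.sum_mul,
          hf.1, hu.1]
        field_simp
        ring)
      (fun x => by
        rw [abs_of_nonneg (div_nonneg (hu.2.1 x) (hpos x).le), div_le_div_iff₀ (hpos x) hs]
        linarith [hle x])
    funext x
    have e := hconst x x₀
    simp only [hu.2.2, hf.2.2, div_one] at e
    rwa [div_eq_one_iff_eq (hpos x).ne'] at e
  · intro f hfe
    rw [mem_extremePoints_iff_left] at hfe
    obtain ⟨hfK, hfe⟩ := hfe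
    have hpos := hposK f hfK
    have hf := (hK f).1 hfK
    refine ⟨hfK, ?_⟩
    have hhar : ∀ x y, ∃ C > 0, ∀ w : G, f (w • y) ≤ C * f (w • x) := by
      intro x y
      obtain ⟨C, hC, h⟩ := harnack_s12 (D := D) hN hconn x y
      exact ⟨C, hC, fun w => h (fun z => f (w • z)) (hshift w f hf.1) (fun z => hf.2.1 _)⟩
    have hext : ∀ (g : G) (C : ℝ), (∀ x, f (g • x) ≤ C * f x) →
        ∃ a > 0, ∀ x, f (g • x) = a * f x := by
      intro g C hC
      have ha := hpos (g • x₀)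
      set a := f (g • x₀) with hadef
      have haC : a ≤ C := by
        have := hC x₀
        rwa [hf.2.2, mul_one] at this
      have hC0 : 0 < C := ha.trans_le haC
      set e := 1 / (2 * C) with he
      have he0 : 0 < e := by positivity
      have heC : e * C = 1 / 2 := by rw [he]; field_simp
      have hea : e * a ≤ 1 / 2 := by
        rw [← heC]; gcongr
      have h1a : 0 < 1 - e * a := by linarith
      refine ⟨a, ha, ?_⟩
      have hsh := hshift g f hf.1
      have hu : (fun x => f (g • x) / a) ∈ Kset b c x₀ := by
        rw [hK]
        refine ⟨fun x => ?_, fun x => div_nonneg (hf.2.1 _) ha.le, div_self ha.ne'⟩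
        simp only [← mul_div_assoc, ← Finset.sum_div]
        rw [hsh x]
      have hv : (fun x => (f x - e * f (g • x)) / (1 - e * a)) ∈ Kset b c x₀ := by
        rw [hK]
        refine ⟨fun x => ?_, fun x => div_nonneg ?_ h1a.le, ?_⟩
        · simp only [← mul_div_assoc, ← Finset.sum_div]
          congr 1
          have e1 : ∀ y ∈ N x, b x y * (f y - e * f (g • y)) =
              b x y * f y - e * (b x y * f (g • y)) := fun y _ => by ring
          rw [Finset.sum_congr rfl e1, Finset.sum_sub_distrib, ← Finset.mul_sum, hsh x, hf.1 x]
          ring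
        · have h1 : e * f (g • x) ≤ e * (C * f x) := by gcongr; exact hC x
          have h2 : e * (C * f x) = 1 / 2 * f x := by rw [← mul_assoc, heC]
          have := hpos x
          linarith
        · simp only [hf.2.2, ← hadef]
          exact div_self h1a.ne'
      have heq := hfe _ hu _ hv ⟨e * a, 1 - e * a, by positivity, h1a, by ring, by
        funext x
        simp only [Pi.add_apply, Pi.smul_apply, smul_eq_mul]
        field_simp
        ring⟩
      intro x
      have := congrFun heq x
      rw [div_eq_iff ha.ne'] at this
      rw [this, mul_comm]
    have hm := fun g : G => multiplicative_of_extreme hpos hhar hcocpt hext g x₀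
    have hmul : ∀ (g : G) x, f (g • x) = f (g • x₀) * f x := by
      intro g x
      obtain ⟨a, _, h⟩ := hm g
      rw [h x, h x₀, hf.2.2, mul_one]
    refine ⟨{ toFun := fun g => f (g • x₀), map_one' := by simp [hf.2.2], map_mul' := ?_ },
      fun g => hpos _, ?_⟩
    · intro g h
      rw [mul_smul, hmul g]
    · intro g
      funext x
      simp only [shift, Pi.smul_apply, smul_eq_mul, MonoidHom.coe_mk, OneHom.coe_mk]
      exact hmul g⁻¹ x

end GraphPaper
end
end

section
/- Let (b,c) be a locally finite and connected graph over X with a cocompact and nilpotent group action G such that H_{b,c} is G-invariant, and fix x₀ ∈ X. Then there exist λ₀ ∈ ℝ and d ∈ ℕ₀ such that, with the sets 𝓜_λ carrying the topology of pointwise convergence: (a) 𝓜_λ is empty for λ > λ₀; (b) 𝓜_{λ₀} consists of exactly one point; (c) for every λ < λ₀, the set 𝓜_λ is homeomorphic to the (d−1)-dimensional sphere (empty if d = 0); (d) for every λ ∈ [−∞, λ₀), the set 𝓜_{(λ,λ₀]} = ⋃_{λ < μ ≤ λ₀} 𝓜_μ is homeomorphic to an open d-dimensional ball. -/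
open MeasureTheory
open scoped BigOperators

noncomputable section

namespace GraphPaper

variable {X : Type*}

variable {G : Type*} [Group G] [MulAction G X]

/-! ### Convex analysis part -/

lemma convex_part {d : ℕ} (L : EuclideanSpace ℝ (Fin d) → ℝ)
    (hL : StrictConcaveOn ℝ Set.univ L)
    (hcpt : ∀ m : ℝ, IsCompact {e | m ≤ L e}) :
    ∃ lam0 : ℝ, (∀ e, L e ≤ lam0) ∧ (∃! e, L e = lam0) ∧
      (∀ l : ℝ, l < lam0 → Nonempty (↥{e | L e = l} ≃ₜ
          ↥(Metric.sphere (0 : EuclideanSpace ℝ (Fin d)) 1))) ∧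
      (∀ l : EReal, l < (lam0 : EReal) → Nonempty (↥{e | l < (L e : EReal)} ≃ₜ
          ↥(Metric.ball (0 : EuclideanSpace ℝ (Fin d)) 1))) := by
  have hcont : Continuous L := by
    rw [← continuousOn_univ]
    exact hL.concaveOn.continuousOn isOpen_univ
  obtain ⟨em, hem, hmax⟩ := (hcpt (L 0)).exists_isMaxOn ⟨0, le_refl (L 0)⟩ hcont.continuousOn
  have hmax' : ∀ e, L e ≤ L em := by
    intro e
    by_cases h : L 0 ≤ L e
    · exact hmax h
    · exact (not_le.1 h).le.trans hem
  have key : ∀ l : ℝ, l < L em → ∃ h : EuclideanSpace ℝ (Fin d) ≃ₜ EuclideanSpace ℝ (Fin d),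
      h '' {e | l < L e} = Metric.ball 0 1 ∧ h '' {e | L e = l} = Metric.sphere 0 1 := by
    intro l hl
    have hint : interior {e | l ≤ L e} = {e | l < L e} := by
      apply Set.Subset.antisymm
      · intro e he
        have h1 : l ≤ L e := interior_subset (s := {e | l ≤ L e}) he
        rcases h1.lt_or_eq with h2 | h2
        · exact h2
        exfalso
        have hne : e ≠ em := by rintro rfl; linarith
        have hpath : Filter.Tendsto (fun t : ℝ => e + t • (e - em)) (nhdsWithin 0 (Set.Ioi 0))
            (nhds e) := by
          have : Continuous (fun t : ℝ => e + t • (e - em)) := by fun_prop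
          have h3 := this.tendsto 0
          simp only [zero_smul, add_zero] at h3
          exact h3.mono_left nhdsWithin_le_nhds
        have h4 := hpath.eventually (isOpen_interior.mem_nhds he)
        obtain ⟨t, ht, ht0⟩ := (h4.and self_mem_nhdsWithin).exists
        have ht0 : (0:ℝ) < t := ht0
        have h5 : l ≤ L (e + t • (e - em)) := interior_subset (s := {e | l ≤ L e}) ht
        have h6 := hL.concaveOn.2 (Set.mem_univ (e + t • (e - em))) (Set.mem_univ em)
          (show (0:ℝ) ≤ 1 / (1 + t) by positivity) (show (0:ℝ) ≤ t / (1 + t) by positivity)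
          (by field_simp)
        have h7 : (1 / (1 + t)) • (e + t • (e - em)) + (t / (1 + t)) • em = e := by
          have : (1 + t) ≠ 0 := by positivity
          ext i
          simp
          field_simp
          ring
        rw [h7] at h6
        simp only [smul_eq_mul] at h6
        have h8 : 0 < t / (1 + t) * (L em - l) := by
          apply mul_pos (by positivity) (by linarith)
        have h9 : 0 ≤ 1 / (1 + t) * (L (e + t • (e - em)) - l) := by
          apply mul_nonneg (by positivity) (by linarith)
        have h10 : 1 / (1 + t) * l + t / (1 + t) * l = l := by field_simp
        nlinarith
      · exact interior_maximal (fun e (he : l < L e) => he.le)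
          (isOpen_lt continuous_const hcont)
    have hcl : closure {e | l ≤ L e} = {e | l ≤ L e} :=
      (isClosed_le continuous_const hcont).closure_eq
    have hfr : frontier {e | l ≤ L e} = {e | L e = l} := by
      rw [frontier, hcl, hint]
      ext e
      simp only [Set.mem_sdiff, Set.mem_ofPred_eq, not_lt]
      exact ⟨fun h => le_antisymm h.2 h.1, fun h => ⟨h.ge, h.le⟩⟩
    have hcv : Convex ℝ {e | l ≤ L e} := by
      simpa using hL.concaveOn.convex_ge l
    obtain ⟨h, h1, -, h3⟩ := exists_homeomorph_image_interior_closure_frontier_eq_unitBall hcv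
      (by rw [hint]; exact ⟨em, hl⟩) (hcpt l).isBounded
    rw [hint] at h1
    rw [hfr] at h3
    exact ⟨h, h1, h3⟩
  refine ⟨L em, hmax', ⟨em, rfl, ?_⟩, ?_, ?_⟩
  · intro e he
    by_contra hne
    have := hL.2 (Set.mem_univ e) (Set.mem_univ em) hne (show (0:ℝ) < 1/2 by norm_num)
      (show (0:ℝ) < 1/2 by norm_num) (by norm_num)
    have h2 := hmax' ((1/2:ℝ) • e + (1/2:ℝ) • em)
    simp only [smul_eq_mul] at this
    have he' : L e = L em := he
    linarith
  · intro l hl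
    obtain ⟨h, -, h2⟩ := key l hl
    exact ⟨(h.image _).trans (Homeomorph.setCongr h2)⟩
  · intro l hl
    induction l using EReal.rec with
    | bot =>
      have : {e | (⊥ : EReal) < (L e : EReal)} = Set.univ := by
        ext e; simp
      rw [this]
      exact ⟨(Homeomorph.Set.univ _).trans Homeomorph.unitBall⟩
    | top => simp at hl
    | coe l =>
      obtain ⟨h, h1, -⟩ := key l (by exact_mod_cast hl)
      have : {e | (l : EReal) < (L e : EReal)} = {e | l < L e} := by
        ext e; simp
      rw [this]
      exact ⟨(h.image _).trans (Homeomorph.setCongr h1)⟩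

/-! ### The core setup -/

/-- Auxiliary data: an invariant locally finite strongly connected weighted graph. -/
structure Setup (G X : Type*) [Group G] [MulAction G X] where
  b : X → X → ℝ
  D : X → ℝ
  N : X → Finset X
  x₀ : X
  V : Finset X
  hpos : ∀ x y, y ∈ N x → 0 < b x y
  conn : ∀ x y, Relation.ReflTransGen (fun u v => v ∈ N u) x y
  hb : ∀ (g : G) x y, b (g • x) (g • y) = b x y
  hN : ∀ (g : G) x y, g • y ∈ N (g • x) ↔ y ∈ N x
  hD : ∀ (g : G) x, D (g • x) = D x
  hV : ∀ x : X, ∃ g : G, ∃ v ∈ V, x = g • v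

namespace Setup

variable {G X : Type*} [Group G] [MulAction G X] (S : Setup G X)

/-- The quotient `H e^h / e^h`. -/
def Q (h : X → ℝ) (x : X) : ℝ := S.D x - ∑ y ∈ S.N x, S.b x y * Real.exp (h y - h x)

/-- Normalized additive functions. -/
def Lz : Submodule ℝ (X → ℝ) where
  carrier := {h | h S.x₀ = 0 ∧ ∀ (g : G) x, h (g • x) = h x + h (g • S.x₀)}
  add_mem' := by
    rintro a b ⟨h1, h2⟩ ⟨h3, h4⟩
    refine ⟨by simp [h1, h3], fun g x => ?_⟩
    simp only [Pi.add_apply]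
    rw [h2 g x, h4 g x]; ring
  zero_mem' := by simp
  smul_mem' := by
    rintro c a ⟨h1, h2⟩
    refine ⟨by simp [h1], fun g x => ?_⟩
    simp only [Pi.smul_apply, smul_eq_mul]
    rw [h2 g x]; ring

lemma V_nonempty : S.V.Nonempty := by
  obtain ⟨_, v, hv, _⟩ := S.hV S.x₀
  exact ⟨v, hv⟩

lemma sum_smul (g : G) (x : X) (F : X → ℝ) :
    ∑ y ∈ S.N (g • x), F y = ∑ y ∈ S.N x, F (g • y) := by
  refine Finset.sum_nbij' (fun y => g⁻¹ • y) (fun y => g • y) ?_ ?_ ?_ ?_ ?_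
  · intro y hy
    rw [← S.hN g]; simpa using hy
  · intro y hy
    exact (S.hN g x y).2 hy
  · intro y _; simp
  · intro y _; simp
  · intro y _; simp

lemma Q_smul {h : X → ℝ} (hh : h ∈ S.Lz) (g : G) (x : X) : S.Q h (g • x) = S.Q h x := by
  unfold Q
  rw [S.hD, S.sum_smul]
  congr 1
  refine Finset.sum_congr rfl fun y _ => ?_
  rw [S.hb, hh.2 g y, hh.2 g x]
  congr 2; ring

lemma Q_continuous (x : X) : Continuous (fun h : X → ℝ => S.Q h x) := by
  unfold Q
  fun_prop

/-- Harnack -/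
lemma harnack (m : ℝ) (x z : X) : ∃ C : ℝ, ∀ h : X → ℝ, (∀ x, m ≤ S.Q h x) → h z - h x ≤ C := by
  induction S.conn x z with
  | refl => exact ⟨0, fun h _ => by simp⟩
  | @tail u v _ huv ih =>
    obtain ⟨C, hC⟩ := ih
    refine ⟨C + Real.log ((S.D u - m) / S.b u v), fun h hh => ?_⟩
    have h1 := hC h hh
    have h2 := hh u
    have hb := S.hpos u v huv
    unfold Q at h2
    have h3 : S.b u v * Real.exp (h v - h u) ≤ ∑ y ∈ S.N u, S.b u y * Real.exp (h y - h u) :=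
      Finset.single_le_sum (f := fun y => S.b u y * Real.exp (h y - h u))
        (fun y hy => mul_nonneg (S.hpos u y hy).le (Real.exp_pos _).le) huv
    have h4 : h v - h u ≤ Real.log ((S.D u - m) / S.b u v) := by
      have h5 : Real.exp (h v - h u) ≤ (S.D u - m) / S.b u v := by
        rw [le_div_iff₀ hb]; nlinarith
      rw [Real.le_log_iff_exp_le ((Real.exp_pos _).trans_le h5)]
      exact h5
    linarith

lemma Lz_closed : IsClosed (S.Lz : Set (X → ℝ)) := by
  have : (S.Lz : Set (X → ℝ)) = {h | h S.x₀ = 0} ∩ ⋂ g : G, ⋂ x : X,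
      {h | h (g • x) = h x + h (g • S.x₀)} := by
    ext h
    simp [Lz]
  rw [this]
  refine IsClosed.inter (isClosed_eq (by fun_prop) (by fun_prop)) ?_
  exact isClosed_iInter fun g => isClosed_iInter fun x =>
    isClosed_eq (by fun_prop) (by fun_prop)

lemma Nm_compact (m : ℝ) : IsCompact {h : S.Lz | ∀ x, m ≤ S.Q h x} := by
  choose C1 hC1 using fun z => S.harnack m S.x₀ z
  choose C2 hC2 using fun z => S.harnack m z S.x₀
  have hK : IsCompact (Set.univ.pi fun z => Set.Icc (-C2 z) (C1 z)) :=
    isCompact_univ_pi fun z => isCompact_Icc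
  have hK2 := S.Lz_closed.isClosedEmbedding_subtypeVal.isCompact_preimage hK
  refine hK2.of_isClosed_subset ?_ ?_
  · rw [Set.ofPred_forall]
    exact isClosed_iInter fun x => isClosed_le continuous_const
      ((S.Q_continuous x).comp continuous_subtype_val)
  · intro h hh
    simp only [Set.mem_preimage, Set.mem_pi, Set.mem_univ, true_implies, Set.mem_Icc]
    intro z
    have h1 := hC1 z h hh
    have h2 := hC2 z h hh
    have h3 : (h : X → ℝ) S.x₀ = 0 := h.2.1
    constructor <;> linarith

/-- minimum of `Q`. -/
def mQ (h : X → ℝ) : ℝ := S.V.inf' S.V_nonempty (fun v => S.Q h v)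

lemma mQ_continuous : Continuous S.mQ := by
  unfold mQ
  exact Continuous.finset_inf'_apply S.V_nonempty (fun v _ => S.Q_continuous v)

lemma lt_mQ_iff {h : X → ℝ} (hh : h ∈ S.Lz) (m : ℝ) : m < S.mQ h ↔ ∀ x, m < S.Q h x := by
  unfold mQ
  rw [Finset.lt_inf'_iff]
  constructor
  · intro H x
    obtain ⟨g, v, hv, rfl⟩ := S.hV x
    rw [S.Q_smul hh]; exact H v hv
  · intro H v _; exact H v

lemma le_mQ_iff {h : X → ℝ} (hh : h ∈ S.Lz) (m : ℝ) : m ≤ S.mQ h ↔ ∀ x, m ≤ S.Q h x := by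
  unfold mQ
  rw [Finset.le_inf'_iff]
  constructor
  · intro H x
    obtain ⟨g, v, hv, rfl⟩ := S.hV x
    rw [S.Q_smul hh]; exact H v hv
  · intro H v _; exact H v

lemma Lz_finiteDimensional : FiniteDimensional ℝ S.Lz := by
  have h1 := S.Nm_compact (S.mQ 0 - 1)
  have h2 : {h : S.Lz | ∀ x, S.mQ 0 - 1 ≤ S.Q h x} ∈ nhds (0 : S.Lz) := by
    have h3 : IsOpen {h : S.Lz | S.mQ 0 - 1 < S.mQ h} :=
      isOpen_lt continuous_const (S.mQ_continuous.comp continuous_subtype_val)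
    refine Filter.mem_of_superset (h3.mem_nhds ?_) ?_
    · simp
    · intro h hh
      exact (S.le_mQ_iff h.2 _).1 (le_of_lt hh)
  have : LocallyCompactSpace S.Lz := h1.locallyCompactSpace_of_mem_nhds_of_addGroup h2
  exact FiniteDimensional.of_locallyCompactSpace ℝ

/-! comparison -/

lemma comparison {k h : X → ℝ} (hk : k ∈ S.Lz) (hh : h ∈ S.Lz)
    (hkh : ∀ g : G, k (g • S.x₀) = h (g • S.x₀)) {m l : ℝ} (hm : ∀ x, m ≤ S.Q k x)
    (hl : ∀ x, S.Q h x = l) : m ≤ l ∧ (m = l → k = h) := by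
  obtain ⟨v, hv, hmin⟩ := Finset.exists_min_image S.V (fun x => k x - h x) S.V_nonempty
  have hmin' : ∀ z, k v - h v ≤ k z - h z := by
    intro z
    obtain ⟨g, w, hw, rfl⟩ := S.hV z
    have := hmin w hw
    rw [hk.2 g w, hh.2 g w, hkh g]
    linarith
  have hterm : ∀ x, (∀ z, k x - h x ≤ k z - h z) → ∀ y ∈ S.N x,
      S.b x y * Real.exp (h y - h x) ≤ S.b x y * Real.exp (k y - k x) := by
    intro x hx y hy
    apply mul_le_mul_of_nonneg_left _ (S.hpos x y hy).le
    apply Real.exp_le_exp.2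
    linarith [hx y]
  constructor
  · have h1 := hm v
    rw [← hl v]
    refine h1.trans ?_
    unfold Q
    exact sub_le_sub_left (Finset.sum_le_sum (hterm v hmin')) _
  · intro hml
    have hstep : ∀ x, (∀ z, k x - h x ≤ k z - h z) → ∀ y ∈ S.N x,
        (∀ z, k y - h y ≤ k z - h z) := by
      intro x hx y hy
      have h1 := hx y
      rcases h1.lt_or_eq with h2 | h2
      · exfalso
        have h3 := hm x
        rw [hml, ← hl x] at h3
        unfold Q at h3
        have h4 : ∑ y ∈ S.N x, S.b x y * Real.exp (h y - h x)
            < ∑ y ∈ S.N x, S.b x y * Real.exp (k y - k x) := by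
          refine Finset.sum_lt_sum (hterm x hx) ⟨y, hy, ?_⟩
          apply mul_lt_mul_of_pos_left _ (S.hpos x y hy)
          apply Real.exp_lt_exp.2
          linarith
        linarith
      · intro z; rw [← h2]; exact hx z
    have hall : ∀ x, ∀ z, k x - h x ≤ k z - h z := by
      intro x
      induction S.conn v x with
      | refl => exact hmin'
      | tail _ huv ih => exact hstep _ ih _ huv
    funext x
    have h1 := hall x S.x₀
    have h2 := hall S.x₀ x
    rw [hk.1, hh.1] at h1 h2
    linarith

lemma Q_concave (h1 h2 : X → ℝ) {t s : ℝ} (ht : 0 < t) (hs : 0 < s) (hts : t + s = 1) (x : X) :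
    t * S.Q h1 x + s * S.Q h2 x ≤ S.Q (t • h1 + s • h2) x ∧
    (t * S.Q h1 x + s * S.Q h2 x = S.Q (t • h1 + s • h2) x →
      ∀ y ∈ S.N x, h1 y - h1 x = h2 y - h2 x) := by
  have hsum : t * S.Q h1 x + s * S.Q h2 x = S.D x - ∑ y ∈ S.N x, S.b x y *
      (t * Real.exp (h1 y - h1 x) + s * Real.exp (h2 y - h2 x)) := by
    unfold Q
    simp only [mul_add, Finset.sum_add_distrib]
    have e1 : ∀ (r : ℝ) (h : X → ℝ), ∑ y ∈ S.N x, S.b x y * (r * Real.exp (h y - h x))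
        = r * ∑ y ∈ S.N x, S.b x y * Real.exp (h y - h x) := by
      intro r h
      rw [Finset.mul_sum]
      exact Finset.sum_congr rfl fun y _ => by ring
    rw [e1, e1]
    linear_combination (S.D x) * hts
  have hexp : ∀ y, (t • h1 + s • h2) y - (t • h1 + s • h2) x
      = t * (h1 y - h1 x) + s * (h2 y - h2 x) := by
    intro y; simp; ring
  have hterm : ∀ y ∈ S.N x, S.b x y * Real.exp ((t • h1 + s • h2) y - (t • h1 + s • h2) x)
      ≤ S.b x y * (t * Real.exp (h1 y - h1 x) + s * Real.exp (h2 y - h2 x)) := by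
    intro y hy
    apply mul_le_mul_of_nonneg_left _ (S.hpos x y hy).le
    rw [hexp]
    have := convexOn_exp.2 (Set.mem_univ (h1 y - h1 x)) (Set.mem_univ (h2 y - h2 x)) ht.le hs.le hts
    simpa using this
  rw [hsum]
  constructor
  · unfold Q
    exact sub_le_sub_left (Finset.sum_le_sum hterm) _
  · intro heq y hy
    by_contra hne
    have : ∑ y ∈ S.N x, S.b x y * Real.exp ((t • h1 + s • h2) y - (t • h1 + s • h2) x)
      < ∑ y ∈ S.N x, S.b x y * (t * Real.exp (h1 y - h1 x) + s * Real.exp (h2 y - h2 x)) := by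
      refine Finset.sum_lt_sum hterm ⟨y, hy, ?_⟩
      apply mul_lt_mul_of_pos_left _ (S.hpos x y hy)
      rw [hexp]
      have := strictConvexOn_exp.2 (Set.mem_univ (h1 y - h1 x)) (Set.mem_univ (h2 y - h2 x))
        hne ht hs hts
      simpa using this
    unfold Q at heq
    linarith

lemma strict_concave {h1 h2 h3 : X → ℝ} (m1 : h1 ∈ S.Lz) (m2 : h2 ∈ S.Lz) (m3 : h3 ∈ S.Lz)
    {t s : ℝ} (ht : 0 < t) (hs : 0 < s) (hts : t + s = 1)
    (h123 : ∀ g : G, h3 (g • S.x₀) = t * h1 (g • S.x₀) + s * h2 (g • S.x₀))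
    {l1 l2 l3 : ℝ} (q1 : ∀ x, S.Q h1 x = l1) (q2 : ∀ x, S.Q h2 x = l2) (q3 : ∀ x, S.Q h3 x = l3)
    (hne : h1 ≠ h2) : t * l1 + s * l2 < l3 := by
  have mc : t • h1 + s • h2 ∈ S.Lz := S.Lz.add_mem (S.Lz.smul_mem _ m1) (S.Lz.smul_mem _ m2)
  obtain ⟨c1, c2⟩ := S.comparison mc m3 (fun g => by simp [h123]) (m := t * l1 + s * l2)
    (fun x => by
      have := (S.Q_concave h1 h2 ht hs hts x).1
      rwa [q1, q2] at this) q3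
  rcases c1.lt_or_eq with h | h
  · exact h
  exfalso
  apply hne
  have heq := c2 h
  have hedge : ∀ x, ∀ y ∈ S.N x, h1 y - h1 x = h2 y - h2 x := by
    intro x
    apply (S.Q_concave h1 h2 ht hs hts x).2
    rw [heq, q1, q2, q3, h]
  funext x
  induction S.conn S.x₀ x with
  | refl => rw [m1.1, m2.1]
  | tail _ huv ih => linarith [hedge _ _ huv]

/-! existence -/

/-- The positive operator. -/
def P (K : ℝ) : (X → ℝ) →ₗ[ℝ] (X → ℝ) where
  toFun f x := ∑ y ∈ S.N x, S.b x y * f y + (K - S.D x) * f x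
  map_add' f g := by
    funext x
    simp only [Pi.add_apply, mul_add, Finset.sum_add_distrib]
    ring
  map_smul' r f := by
    funext x
    simp only [Pi.smul_apply, smul_eq_mul, RingHom.id_apply, mul_add, Finset.mul_sum]
    congr 1
    · exact Finset.sum_congr rfl fun y _ => by ring
    · ring

lemma P_apply (K : ℝ) (f : X → ℝ) (x : X) :
    S.P K f x = ∑ y ∈ S.N x, S.b x y * f y + (K - S.D x) * f x := rfl

lemma P_mult (K : ℝ) (r : G → ℝ) (f : X → ℝ) (hf : ∀ g x, f (g • x) = r g * f x) (g : G) (x : X) :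
    S.P K f (g • x) = r g * S.P K f x := by
  rw [P_apply, P_apply, S.sum_smul, S.hD, hf, mul_add, Finset.mul_sum]
  congr 1
  · refine Finset.sum_congr rfl fun y _ => ?_
    rw [S.hb, hf]; ring
  · ring

lemma Pn_mult (K : ℝ) (r : G → ℝ) (f : X → ℝ) (hf : ∀ g x, f (g • x) = r g * f x) (n : ℕ) :
    ∀ (g : G) (x : X), ((S.P K) ^ n) f (g • x) = r g * ((S.P K) ^ n) f x := by
  induction n with
  | zero => simpa using hf
  | succ n ih =>
    rw [pow_succ']
    exact S.P_mult K r _ ih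

lemma Q_eq (K m a : ℝ) (F h : X → ℝ) (hF : ∀ x, 0 < F x) (hh : ∀ x, h x = Real.log (F x) - a)
    (x : X) : (S.Q h x - m) * F x = ((K - m) • F - S.P K F) x := by
  unfold Q
  simp only [Pi.sub_apply, Pi.smul_apply, smul_eq_mul, P_apply]
  have h1 : (∑ y ∈ S.N x, S.b x y * Real.exp (h y - h x)) * F x = ∑ y ∈ S.N x, S.b x y * F y := by
    rw [Finset.sum_mul]
    refine Finset.sum_congr rfl fun y _ => ?_
    have : h y - h x = Real.log (F y) - Real.log (F x) := by rw [hh, hh]; ring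
    rw [this, Real.exp_sub, Real.exp_log (hF y), Real.exp_log (hF x)]
    have := (hF x).ne'
    field_simp
  linear_combination -h1

lemma improve {h : X → ℝ} (hh : h ∈ S.Lz) {m : ℝ} (hm : ∀ x, m ≤ S.Q h x) {x1 : X}
    (hx1 : m < S.Q h x1) : ∃ h' ∈ S.Lz, (∀ g : G, h' (g • S.x₀) = h (g • S.x₀)) ∧
      ∀ x, m < S.Q h' x := by
  obtain ⟨K, hK⟩ : ∃ K : ℝ, ∀ x, S.D x < K := by
    obtain ⟨v, hv, hmax⟩ := Finset.exists_max_image S.V S.D S.V_nonempty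
    refine ⟨S.D v + 1, fun x => ?_⟩
    obtain ⟨g, w, hw, rfl⟩ := S.hV x
    rw [S.hD]; linarith [hmax w hw]
  set f : X → ℝ := fun x => Real.exp (h x) with hf
  set u : X → ℝ := (K - m) • f - S.P K f with hu
  have hfpos : ∀ x, 0 < f x := fun x => Real.exp_pos _
  have hu_eq : ∀ x, (S.Q h x - m) * f x = u x :=
    S.Q_eq K m 0 f h hfpos (fun x => by simp [hf])
  have hPpos : ∀ w : X → ℝ, (∀ x, 0 ≤ w x) → (∀ x, 0 ≤ S.P K w x) ∧
      (∀ x, 0 < w x → 0 < S.P K w x) ∧ (∀ x, ∀ y ∈ S.N x, 0 < w y → 0 < S.P K w x) := by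
    intro w hw
    have hs : ∀ x, 0 ≤ ∑ y ∈ S.N x, S.b x y * w y := fun x =>
      Finset.sum_nonneg fun y hy => mul_nonneg (S.hpos x y hy).le (hw y)
    have hd : ∀ x, 0 < K - S.D x := fun x => sub_pos.2 (hK x)
    refine ⟨fun x => ?_, fun x hx => ?_, fun x y hy hwy => ?_⟩
    · rw [P_apply]; exact add_nonneg (hs x) (mul_nonneg (hd x).le (hw x))
    · rw [P_apply]; exact add_pos_of_nonneg_of_pos (hs x) (mul_pos (hd x) hx)
    · rw [P_apply]
      refine add_pos_of_pos_of_nonneg ?_ (mul_nonneg (hd x).le (hw x))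
      exact Finset.sum_pos' (fun y hy => mul_nonneg (S.hpos x y hy).le (hw y))
        ⟨y, hy, mul_pos (S.hpos x y hy) hwy⟩
  have hu0 : ∀ x, 0 ≤ u x := fun x => by
    rw [← hu_eq]; exact mul_nonneg (sub_nonneg.2 (hm x)) (hfpos x).le
  have hnn : ∀ n x, 0 ≤ ((S.P K) ^ n) u x := by
    intro n
    induction n with
    | zero => simpa using hu0
    | succ n ih => rw [pow_succ']; exact (hPpos _ ih).1
  have hfn : ∀ n x, 0 < ((S.P K) ^ n) f x := by
    intro n
    induction n with
    | zero => simpa using hfpos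
    | succ n ih => rw [pow_succ']; exact fun x => (hPpos _ (fun x => (ih x).le)).2.1 x (ih x)
  have hmono : ∀ x n k, n ≤ k → 0 < ((S.P K) ^ n) u x → 0 < ((S.P K) ^ k) u x := by
    intro x n k hnk h0
    induction k, hnk using Nat.le_induction with
    | base => exact h0
    | succ k _ ih => rw [pow_succ']; exact (hPpos _ (hnn k)).2.1 x ih
  have hreach : ∀ x, ∃ n, 0 < ((S.P K) ^ n) u x := by
    intro x
    induction S.conn x x1 using Relation.ReflTransGen.head_induction_on with
    | refl =>
      refine ⟨0, ?_⟩
      have := hu_eq x1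
      simp only [pow_zero, Module.End.one_apply]
      rw [← this]
      exact mul_pos (sub_pos.2 hx1) (hfpos _)
    | head hxy _ ih =>
      obtain ⟨n, hn⟩ := ih
      refine ⟨n + 1, ?_⟩
      rw [pow_succ']
      exact (hPpos _ (hnn n)).2.2 _ _ hxy hn
  choose n hn using hreach
  set M := S.V.sup n with hM
  have hfm : ∀ (g : G) x, f (g • x) = Real.exp (h (g • S.x₀)) * f x := by
    intro g x
    simp only [hf]
    rw [hh.2 g x, Real.exp_add, mul_comm]
  have hFm := S.Pn_mult K _ f hfm M
  have hcomm : ((S.P K) ^ M) u = (K - m) • (((S.P K) ^ M) f) - S.P K (((S.P K) ^ M) f) := by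
    rw [hu, map_sub, map_smul]
    congr 1
    rw [← Module.End.mul_apply, ← Module.End.mul_apply, ← pow_succ, ← pow_succ']
  set F := ((S.P K) ^ M) f with hFdef
  have hFpos : ∀ x, 0 < F x := hfn M
  have hlog : ∀ (g : G) x, Real.log (F (g • x)) = h (g • S.x₀) + Real.log (F x) := by
    intro g x
    rw [hFm, Real.log_mul (Real.exp_pos _).ne' (hFpos x).ne', Real.log_exp]
  have hmem : (fun x => Real.log (F x) - Real.log (F S.x₀)) ∈ S.Lz := by
    refine ⟨by simp, fun g x => ?_⟩
    simp only [hlog]; ring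
  refine ⟨fun x => Real.log (F x) - Real.log (F S.x₀), hmem, fun g => by simp [hlog], ?_⟩
  rw [← S.lt_mQ_iff hmem]
  unfold mQ
  rw [Finset.lt_inf'_iff]
  intro v hv
  have h1 := S.Q_eq K m (Real.log (F S.x₀)) F _ hFpos (fun x => rfl) v
  rw [← hcomm] at h1
  have h2 := hmono v (n v) M (Finset.le_sup hv) (hn v)
  rw [← h1] at h2
  have h3 := (pos_iff_pos_of_mul_pos h2).2 (hFpos v)
  linarith

lemma existence {h0 : X → ℝ} (hh : h0 ∈ S.Lz) : ∃ h ∈ S.Lz,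
    (∀ g : G, h (g • S.x₀) = h0 (g • S.x₀)) ∧ ∃ l, ∀ x, S.Q h x = l := by
  have hA : IsCompact ({h : S.Lz | ∀ x, S.mQ h0 ≤ S.Q h x} ∩
      {h : S.Lz | ∀ g : G, (h : X → ℝ) (g • S.x₀) = h0 (g • S.x₀)}) := by
    apply (S.Nm_compact _).inter_right
    rw [Set.ofPred_forall]
    exact isClosed_iInter fun g => isClosed_eq
      ((continuous_apply _).comp continuous_subtype_val) continuous_const
  obtain ⟨h, ⟨hh1, hh2⟩, hmax⟩ := hA.exists_isMaxOn
    ⟨⟨h0, hh⟩, (S.le_mQ_iff hh _).1 le_rfl, fun g => rfl⟩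
    (S.mQ_continuous.comp continuous_subtype_val).continuousOn
  refine ⟨h, h.2, hh2, S.mQ h, ?_⟩
  have hge := (S.le_mQ_iff h.2 _).1 le_rfl
  by_contra! hcon
  obtain ⟨x1, hx1⟩ := hcon
  obtain ⟨h', hm', he', hq'⟩ := S.improve h.2 hge (lt_of_le_of_ne (hge x1) (Ne.symm hx1))
  have h1 := (S.le_mQ_iff h.2 _).2 hh1
  have h2 := hmax (a := ⟨h', hm'⟩) ⟨fun x => h1.trans (hq' x).le, fun g => by
    have := hh2 g
    simp only [he', this]⟩
  have h3 := (S.lt_mQ_iff hm' _).2 hq'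
  simp only [Function.comp, Set.mem_ofPred_eq] at h2
  linarith

/-! parametrization -/

/-- The character of an additive function. -/
def Phi : S.Lz →ₗ[ℝ] (G → ℝ) where
  toFun h g := (h : X → ℝ) (g • S.x₀)
  map_add' _ _ := rfl
  map_smul' _ _ := rfl

theorem core : ∃ (d : ℕ) (L : EuclideanSpace ℝ (Fin d) → ℝ)
    (s : EuclideanSpace ℝ (Fin d) → (X → ℝ)),
    StrictConcaveOn ℝ Set.univ L ∧ (∀ m : ℝ, IsCompact {e | m ≤ L e}) ∧
    Topology.IsEmbedding s ∧
    (∀ h l, (h ∈ S.Lz ∧ ∀ x, S.Q h x = l) ↔ ∃ e, s e = h ∧ L e = l) := by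
  have hfd := S.Lz_finiteDimensional
  set d := Module.finrank ℝ (LinearMap.range S.Phi) with hd
  have e0 : LinearMap.range S.Phi ≃ₗ[ℝ] EuclideanSpace ℝ (Fin d) :=
    LinearEquiv.ofFinrankEq _ _ (by simp [hd])
  set T : S.Lz →ₗ[ℝ] EuclideanSpace ℝ (Fin d) := e0.toLinearMap ∘ₗ S.Phi.rangeRestrict with hT
  have hTsurj : Function.Surjective T := by
    intro e
    obtain ⟨h, hh⟩ := S.Phi.surjective_rangeRestrict (e0.symm e)
    exact ⟨h, by simp [hT, hh]⟩
  have hTeq : ∀ h k : S.Lz, T h = T k ↔ ∀ g : G, (h : X → ℝ) (g • S.x₀) = (k : X → ℝ) (g • S.x₀) := by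
    intro h k
    simp only [hT, LinearMap.comp_apply, LinearEquiv.coe_coe, e0.injective.eq_iff]
    rw [Subtype.ext_iff]
    exact funext_iff
  have hTcont : Continuous T := T.continuous_of_finiteDimensional
  have hex : ∀ e, ∃ h : S.Lz, T h = e ∧ ∃ l, ∀ x, S.Q h x = l := by
    intro e
    obtain ⟨h0, rfl⟩ := hTsurj e
    obtain ⟨h, hm, he, l, hl⟩ := S.existence h0.2
    exact ⟨⟨h, hm⟩, (hTeq _ _).2 he, l, hl⟩
  choose s hsT L hL using hex
  have huniq : ∀ (h : S.Lz) l, (∀ x, S.Q h x = l) → h = s (T h) ∧ l = L (T h) := by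
    intro h l hl
    have h1 := (hTeq _ _).1 (hsT (T h))
    obtain ⟨a1, a2⟩ := S.comparison h.2 (s (T h)).2 (fun g => (h1 g).symm)
      (fun x => (hl x).ge) (hL (T h))
    obtain ⟨a3, a4⟩ := S.comparison (s (T h)).2 h.2 h1
      (fun x => (hL (T h) x).ge) hl
    have := le_antisymm a1 a3
    exact ⟨Subtype.ext (a2 this), this⟩
  have hconc : StrictConcaveOn ℝ Set.univ L := by
    refine ⟨convex_univ, fun e1 _ e2 _ hne t r ht hr htr => ?_⟩
    have h1 : T (s (t • e1 + r • e2)) = T (t • s e1 + r • s e2) := by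
      rw [map_add, map_smul, map_smul, hsT, hsT, hsT]
    refine S.strict_concave (s e1).2 (s e2).2 (s (t • e1 + r • e2)).2 ht hr htr ?_
      (hL e1) (hL e2) (hL _) ?_
    · intro g
      rw [(hTeq _ _).1 h1 g]
      simp
    · intro h
      apply hne
      rw [← hsT e1, ← hsT e2, Subtype.ext h]
  have hcpt : ∀ m : ℝ, IsCompact {e | m ≤ L e} := by
    intro m
    have : {e | m ≤ L e} = T '' {h : S.Lz | ∀ x, m ≤ S.Q h x} := by
      ext e
      constructor
      · intro he
        exact ⟨s e, fun x => by rw [hL]; exact he, hsT e⟩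
      · rintro ⟨h, hh, rfl⟩
        exact (S.comparison h.2 (s (T h)).2 (fun g => ((hTeq _ _).1 (hsT (T h)) g).symm) hh
          (hL _)).1
    rw [this]
    exact (S.Nm_compact m).image hTcont
  have hLcont : Continuous L := by
    rw [← continuousOn_univ]
    exact hconc.concaveOn.continuousOn isOpen_univ
  have hscont : Continuous s := by
    rw [continuous_iff_continuousAt]
    intro e
    rw [ContinuousAt, Filter.tendsto_iff_ultrafilter]
    intro U hU
    have hC := S.Nm_compact (L e - 1)
    have hmem : {h : S.Lz | ∀ x, L e - 1 ≤ S.Q h x} ∈ Ultrafilter.map s U := by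
      have h1 : {e' | L e - 1 < L e'} ∈ nhds e :=
        (isOpen_lt continuous_const hLcont).mem_nhds (by simp)
      have h2 : {e' | L e - 1 < L e'} ∈ U := hU h1
      rw [Ultrafilter.mem_map]
      refine Filter.mem_of_superset h2 ?_
      intro e' he' x
      rw [hL]; exact le_of_lt he'
    obtain ⟨h, hh, hlim⟩ := hC.ultrafilter_le_nhds _ (Filter.le_principal_iff.2 hmem)
    have hlim' : Filter.Tendsto s U (nhds h) := hlim
    have h1 : T h = e := by
      have a1 := (hTcont.tendsto h).comp hlim'
      have a2 : T ∘ s = id := funext hsT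
      rw [a2] at a1
      exact tendsto_nhds_unique a1 hU
    have h2 : ∀ x, S.Q h x = L e := by
      intro x
      have a1 := (((S.Q_continuous x).comp continuous_subtype_val).tendsto h).comp hlim'
      have a2 : ((fun h : X → ℝ => S.Q h x) ∘ Subtype.val) ∘ s = L := funext fun e' => hL e' x
      rw [a2] at a1
      exact tendsto_nhds_unique a1 ((hLcont.tendsto e).mono_left hU)
    have h3 := (huniq h _ h2).1
    rw [h1] at h3
    rw [← h3]
    exact hlim'
  refine ⟨d, L, fun e => (s e : X → ℝ), hconc, hcpt, ?_, ?_⟩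
  · exact Topology.IsEmbedding.subtypeVal.comp
      (Function.LeftInverse.isEmbedding (f := T) hsT hTcont hscont)
  · intro h l
    constructor
    · rintro ⟨hm, hq⟩
      obtain ⟨a1, a2⟩ := huniq ⟨h, hm⟩ l hq
      exact ⟨_, congrArg Subtype.val a1.symm, a2.symm⟩
    · rintro ⟨e, rfl, rfl⟩
      exact ⟨(s e).2, hL e⟩

end Setup

/-! ### Linking with the graph -/

section Link

variable (b : X → X → ℝ) (c : X → ℝ)

lemma schr_eq (hb0 : ∀ x y, 0 ≤ b x y) (hlf : ∀ x : X, {y | 0 < b x y}.Finite) (f : X → ℝ)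
    (x : X) : schrodinger b c f x = deg b c x * f x - ∑ y ∈ (hlf x).toFinset, b x y * f y := by
  have h0 : ∀ y ∉ (hlf x).toFinset, b x y = 0 := by
    intro y hy
    simp only [Set.Finite.mem_toFinset, Set.mem_ofPred_eq, not_lt] at hy
    exact le_antisymm hy (hb0 x y)
  unfold schrodinger deg
  rw [tsum_eq_sum (s := (hlf x).toFinset) (fun y hy => by simp [h0 y hy]),
    tsum_eq_sum (s := (hlf x).toFinset) h0]
  simp only [mul_sub, Finset.sum_sub_distrib, ← Finset.sum_mul]
  ring

lemma inDom_all (hb0 : ∀ x y, 0 ≤ b x y) (hlf : ∀ x : X, {y | 0 < b x y}.Finite) (f : X → ℝ) :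
    InDom b f := by
  intro x
  refine summable_of_ne_finset_zero (s := (hlf x).toFinset) ?_
  intro y hy
  simp only [Set.Finite.mem_toFinset, Set.mem_ofPred_eq, not_lt] at hy
  rw [le_antisymm hy (hb0 x y), zero_mul]

lemma inv_aux (hb0 : ∀ x y, 0 ≤ b x y) (hbd : ∀ x, b x x = 0)
    (hlf : ∀ x : X, {y | 0 < b x y}.Finite)
    (hH : HInvOn b c (Set.univ : Set G)) (g : G) :
    (∀ x y, b (g • x) (g • y) = b x y) ∧ ∀ x, deg b c (g • x) = deg b c x := by
  classical
  have hs : ∀ x y, schrodinger b c (Pi.single y 1) x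
      = deg b c x * (Pi.single y 1 : X → ℝ) x - b x y := by
    intro x y
    rw [schr_eq b c hb0 hlf]
    congr 1
    simp only [Pi.single_apply, mul_ite, mul_one, mul_zero, Finset.sum_ite_eq']
    split_ifs with h
    · rfl
    · simp only [Set.Finite.mem_toFinset, Set.mem_ofPred_eq, not_lt] at h
      exact (le_antisymm h (hb0 x y)).symm
  have hsh : ∀ y : X, shift g (Pi.single y 1 : X → ℝ) = Pi.single (g • y) 1 := by
    intro y
    funext x
    simp only [shift, Pi.single_apply, inv_smul_eq_iff]
  have key : ∀ x y, deg b c (g • x) * (Pi.single y 1 : X → ℝ) x - b (g • x) (g • y)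
      = deg b c x * (Pi.single y 1 : X → ℝ) x - b x y := by
    intro x y
    have h1 := congrFun (hH g (Set.mem_univ g) (Pi.single y 1) (inDom_all b hb0 hlf _)).2 (g • x)
    rw [hsh, hs] at h1
    simp only [shift, inv_smul_smul] at h1
    rw [hs] at h1
    rw [← h1]
    simp [Pi.single_apply]
  have hdeg : ∀ x, deg b c (g • x) = deg b c x := by
    intro x
    have := key x x
    simpa [hbd] using this
  refine ⟨fun x y => ?_, hdeg⟩
  have := key x y
  rw [hdeg] at this
  linarith

/-- The setup associated to the graph. -/
def mkSetup (hb0 : ∀ x y, 0 ≤ b x y) (hbd : ∀ x, b x x = 0)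
    (hlf : ∀ x : X, {y | 0 < b x y}.Finite) (hconn : Connected b)
    (V : Finset X) (hV : ∀ x : X, ∃ g : G, ∃ v ∈ V, x = g • v)
    (hH : HInvOn b c (Set.univ : Set G)) (x₀ : X) : Setup G X where
  b := b
  D := deg b c
  N x := (hlf x).toFinset
  x₀ := x₀
  V := V
  hpos x y hy := by simpa using hy
  conn x y := by simpa using hconn x y
  hb g := (inv_aux b c hb0 hbd hlf hH g).1
  hN g x y := by simp [(inv_aux b c hb0 hbd hlf hH g).1]
  hD g := (inv_aux b c hb0 hbd hlf hH g).2
  hV := hV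

lemma mem_MsetLam (hb0 : ∀ x y, 0 ≤ b x y) (hbd : ∀ x, b x x = 0)
    (hlf : ∀ x : X, {y | 0 < b x y}.Finite) (hconn : Connected b)
    (V : Finset X) (hV : ∀ x : X, ∃ g : G, ∃ v ∈ V, x = g • v)
    (hH : HInvOn b c (Set.univ : Set G)) (x₀ : X) (f : X → ℝ) (l : ℝ) :
    f ∈ MsetLam G b c x₀ l ↔ ∃ h : X → ℝ,
      (h ∈ (mkSetup b c hb0 hbd hlf hconn V hV hH x₀).Lz ∧
        ∀ x, (mkSetup b c hb0 hbd hlf hconn V hV hH x₀).Q h x = l) ∧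
      (fun x => Real.exp (h x)) = f := by
  have hQ : ∀ (h : X → ℝ) x, ((mkSetup b c hb0 hbd hlf hconn V hV hH x₀).Q h x)
      * Real.exp (h x) = schrodinger b c (fun x => Real.exp (h x)) x := by
    intro h x
    rw [schr_eq b c hb0 hlf]
    change (deg b c x - ∑ y ∈ (hlf x).toFinset, b x y * Real.exp (h y - h x)) * _ = _
    rw [sub_mul, Finset.sum_mul]
    congr 1
    refine Finset.sum_congr rfl fun y _ => ?_
    rw [mul_assoc, ← Real.exp_add]
    congr 2; ring
  constructor
  · rintro ⟨hK, γ, hγ, hmul⟩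
    have hcl : IsClosed {f : X → ℝ | (∀ x, schrodinger b c f x = l * f x) ∧
        (∀ x, 0 ≤ f x) ∧ f x₀ = 1} := by
      have e : {f : X → ℝ | (∀ x, schrodinger b c f x = l * f x) ∧
        (∀ x, 0 ≤ f x) ∧ f x₀ = 1} = (⋂ x, {f : X → ℝ | deg b c x * f x -
          ∑ y ∈ (hlf x).toFinset, b x y * f y = l * f x}) ∩ ((⋂ x, {f : X → ℝ | 0 ≤ f x}) ∩
          {f : X → ℝ | f x₀ = 1}) := by
        ext f
        simp [schr_eq b c hb0 hlf]
      rw [e]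
      refine IsClosed.inter (isClosed_iInter fun x => isClosed_eq (by fun_prop) (by fun_prop))
        (IsClosed.inter (isClosed_iInter fun x => isClosed_le (by fun_prop) (by fun_prop))
          (isClosed_eq (by fun_prop) (by fun_prop)))
    have hf : f ∈ {f : X → ℝ | (∀ x, schrodinger b c f x = l * f x) ∧
        (∀ x, 0 ≤ f x) ∧ f x₀ = 1} := by
      refine closure_minimal ?_ hcl hK
      rintro f ⟨-, h1, h2, -, h3⟩
      exact ⟨fun x => congrFun h1 x, h2, h3⟩
    obtain ⟨h1, h2, h3⟩ := hf
    have hpos : ∀ x, 0 < f x := by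
      intro x
      refine lt_of_le_of_ne (h2 x) fun h0 => ?_
      have hzz : ∀ z, f z = 0 := by
        intro z
        induction hconn x z with
        | refl => exact h0.symm
        | @tail u v _ huv ih =>
          have h4 := h1 u
          rw [schr_eq b c hb0 hlf, ih] at h4
          have h5 : ∑ y ∈ (hlf u).toFinset, b u y * f y = 0 := by linarith
          rw [Finset.sum_eq_zero_iff_of_nonneg
            (fun y _ => mul_nonneg (hb0 u y) (h2 y))] at h5
          have h6 := h5 v (by simpa using huv)
          exact (mul_eq_zero.1 h6).resolve_left huv.ne'
      have hz := hzz x₀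
      rw [h3] at hz
      exact one_ne_zero hz
    have hmul' : ∀ (g : G) x, f (g • x) = γ g * f x := by
      intro g x
      have := congrFun (hmul g⁻¹) x
      simpa [shift] using this
    have hexp : (fun x => Real.exp (Real.log (f x))) = f := funext fun x => Real.exp_log (hpos x)
    refine ⟨fun x => Real.log (f x), ⟨⟨?_, ?_⟩, ?_⟩, hexp⟩
    · change Real.log (f x₀) = 0
      rw [h3, Real.log_one]
    · intro g x
      change Real.log (f (g • x)) = Real.log (f x) + Real.log (f (g • x₀))
      rw [hmul' g x, hmul' g x₀, h3, mul_one, Real.log_mul (hγ g).ne' (hpos x).ne', add_comm]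
    · intro x
      have h4 := hQ (fun x => Real.log (f x)) x
      simp only [hexp] at h4
      rw [h1 x, Real.exp_log (hpos x)] at h4
      exact mul_right_cancel₀ (hpos x).ne' h4
  · rintro ⟨h, ⟨hm, hq⟩, rfl⟩
    have hm1 : h x₀ = 0 := hm.1
    have hm2 : ∀ (g : G) x, h (g • x) = h x + h (g • x₀) := hm.2
    refine ⟨subset_closure ⟨inDom_all b hb0 hlf _, ?_, fun x => (Real.exp_pos _).le, ?_, ?_⟩, ?_⟩
    · funext x
      rw [← hQ, hq]
    · intro h0
      have := congrFun h0 x₀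
      exact (Real.exp_pos _).ne' this
    · simp [hm1]
    · refine ⟨⟨⟨fun g => Real.exp (h (g • x₀)), by simp [hm1]⟩, ?_⟩, fun g => Real.exp_pos _, ?_⟩
      · intro g g'
        change Real.exp (h ((g * g') • x₀)) = Real.exp (h (g • x₀)) * Real.exp (h (g' • x₀))
        rw [mul_smul, hm2 g (g' • x₀), Real.exp_add, mul_comm]
      · intro g
        funext x
        change Real.exp (h (g⁻¹ • x)) = Real.exp (h (g⁻¹ • x₀)) * Real.exp (h x)
        rw [hm2 g⁻¹ x, Real.exp_add, mul_comm]

lemma exp_embedding : Topology.IsEmbedding (fun (h : X → ℝ) (x : X) => Real.exp (h x)) := by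
  have h1 : Topology.IsEmbedding Real.exp := Real.isOpenEmbedding_exp.isEmbedding
  exact Topology.IsEmbedding.piMap (fun _ : X => h1)

end Link

/-- Structure of the family `(𝓜_λ)_{λ∈ℝ}`: empty above `λ₀`, a point
at `λ₀`, a `(d-1)`-sphere below `λ₀`, and the unions `𝓜_{(λ,λ₀]}` are open `d`-balls. -/
theorem MsetLam_structure {X : Type*} [Countable X] {G : Type*} [Group G]
    [MulAction G X] [Group.IsNilpotent G]
    (b : X → X → ℝ) (c : X → ℝ)
    (hb0 : ∀ x y, 0 ≤ b x y) (hbd : ∀ x, b x x = 0) (hbs : ∀ x, Summable (b x))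
    (hlf : ∀ x : X, {y | 0 < b x y}.Finite) (hconn : Connected b)
    (hcocpt : CocompactAction G X)
    (hH : HInvOn b c (Set.univ : Set G)) (x₀ : X) :
    ∃ (lam0 : ℝ) (d : ℕ),
      (∀ l : ℝ, lam0 < l → MsetLam G b c x₀ l = ∅) ∧
      (∃! f : X → ℝ, f ∈ MsetLam G b c x₀ lam0) ∧
      (∀ l : ℝ, l < lam0 →
        Nonempty (↥(MsetLam G b c x₀ l) ≃ₜ
          ↥(Metric.sphere (0 : EuclideanSpace ℝ (Fin d)) 1))) ∧
      (∀ l : EReal, l < (lam0 : EReal) →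
        Nonempty (↥{f : X → ℝ | ∃ m : ℝ, l < (m : EReal) ∧ m ≤ lam0 ∧
            f ∈ MsetLam G b c x₀ m} ≃ₜ
          ↥(Metric.ball (0 : EuclideanSpace ℝ (Fin d)) 1))) := by
  obtain ⟨V, hV⟩ := hcocpt
  obtain ⟨d, L, s, hconc, hcpt, hemb, hiff⟩ :=
    (mkSetup b c hb0 hbd hlf hconn V hV hH x₀).core
  obtain ⟨lam0, hle, huniq, hsph, hball⟩ := convex_part L hconc hcpt
  have hE : Topology.IsEmbedding (fun e => (fun x => Real.exp (s e x))) :=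
    exp_embedding.comp hemb
  have hmem : ∀ f l, f ∈ MsetLam G b c x₀ l ↔ ∃ e, (fun x => Real.exp (s e x)) = f ∧ L e = l := by
    intro f l
    rw [mem_MsetLam b c hb0 hbd hlf hconn V hV hH x₀]
    simp only [hiff]
    constructor
    · rintro ⟨h, ⟨e, rfl, he⟩, hf⟩
      exact ⟨e, hf, he⟩
    · rintro ⟨e, hf, he⟩
      exact ⟨s e, ⟨e, rfl, he⟩, hf⟩
  refine ⟨lam0, d, ?_, ?_, ?_, ?_⟩
  · intro l hl
    ext f
    simp only [hmem, Set.mem_empty_iff_false, iff_false]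
    rintro ⟨e, -, he⟩
    linarith [hle e]
  · obtain ⟨e, he, hu⟩ := huniq
    refine ⟨fun x => Real.exp (s e x), (hmem _ _).2 ⟨e, rfl, he⟩, ?_⟩
    intro f hf
    obtain ⟨e', rfl, he'⟩ := (hmem _ _).1 hf
    rw [hu e' he']
  · intro l hl
    obtain ⟨φ⟩ := hsph l hl
    have hset : (fun e => (fun x => Real.exp (s e x))) '' {e | L e = l} = MsetLam G b c x₀ l := by
      ext f
      rw [hmem]
      constructor
      · rintro ⟨e, he, rfl⟩; exact ⟨e, rfl, he⟩
      · rintro ⟨e, rfl, he⟩; exact ⟨e, he, rfl⟩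
    exact ⟨((hE.homeomorphImage _).trans (Homeomorph.setCongr hset)).symm.trans φ⟩
  · intro l hl
    obtain ⟨φ⟩ := hball l hl
    have hset : (fun e => (fun x => Real.exp (s e x))) '' {e | l < (L e : EReal)} =
        {f : X → ℝ | ∃ m : ℝ, l < (m : EReal) ∧ m ≤ lam0 ∧ f ∈ MsetLam G b c x₀ m} := by
      ext f
      constructor
      · rintro ⟨e, he, rfl⟩
        exact ⟨L e, he, hle e, (hmem _ _).2 ⟨e, rfl, rfl⟩⟩
      · rintro ⟨m, hm, -, hf⟩
        obtain ⟨e, rfl, rfl⟩ := (hmem _ _).1 hf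
        exact ⟨e, hm, rfl⟩
    exact ⟨((hE.homeomorphImage _).trans (Homeomorph.setCongr hset)).symm.trans φ⟩

end GraphPaper
end
end

section
/- Let (b,c) be a locally finite connected graph over X with a free and cocompact action of ℤ^d on X such that b and c are ℤ^d-invariant, and fix x₀ ∈ X. Then for every α ∈ ℝ^d there exist a unique λ ∈ ℝ and a unique strictly positive function f in the domain of H_{b,c} with f(x₀) = 1 such that f is λ-harmonic and f(z·x) = exp(⟨α, z⟩) · f(x) for all z ∈ ℤ^d and x ∈ X. -/
open MeasureTheory
open scoped BigOperators

noncomputable section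

namespace GraphPaper

variable {X : Type*}

variable {G : Type*} [Group G] [MulAction G X]

theorem pf_iter_nonneg {Q : Type*} (T : (Q → ℝ) →ₗ[ℝ] (Q → ℝ))
    (hpos : ∀ u, (∀ q, 0 ≤ u q) → ∀ q, 0 ≤ T u q) (u : Q → ℝ) (hu : ∀ q, 0 ≤ u q) (n : ℕ) :
    ∀ q, 0 ≤ (T ^ n) u q := by
  induction n with
  | zero => simpa using hu
  | succ n ih => rw [pow_succ']; exact hpos _ ih

theorem pf_iter_pos {Q : Type*} [Finite Q] (T : (Q → ℝ) →ₗ[ℝ] (Q → ℝ)) (R : Q → Q → Prop)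
    (hpos : ∀ u, (∀ q, 0 ≤ u q) → ∀ q, 0 ≤ T u q)
    (hdiag : ∀ u, (∀ q, 0 ≤ u q) → ∀ q, 0 < u q → 0 < T u q)
    (hR : ∀ u, (∀ q, 0 ≤ u q) → ∀ p q, R p q → 0 < u q → 0 < T u p)
    (hconn : ∀ p q, Relation.ReflTransGen R p q)
    (u : Q → ℝ) (hu : ∀ q, 0 ≤ u q) (hu0 : u ≠ 0) : ∃ n : ℕ, ∀ p, 0 < (T ^ n) u p := by
  obtain ⟨q, hq⟩ := Function.ne_iff.1 hu0
  have hq : 0 < u q := lt_of_le_of_ne (hu q) (Ne.symm hq)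
  have key : ∀ p, ∀ᶠ n : ℕ in Filter.atTop, 0 < (T ^ n) u p := by
    intro p
    have hmono : ∀ p n, 0 < (T ^ n) u p → ∀ m, n ≤ m → 0 < (T ^ m) u p := by
      intro p n h m hm
      induction m, hm using Nat.le_induction with
      | base => exact h
      | succ m _ ih => rw [pow_succ']; exact hdiag _ (pf_iter_nonneg T hpos u hu m) _ ih
    suffices h : ∃ n : ℕ, 0 < (T ^ n) u p by
      obtain ⟨n, hn⟩ := h
      exact Filter.eventually_atTop.2 ⟨n, hmono p n hn⟩
    have h := hconn p q
    induction h using Relation.ReflTransGen.head_induction_on with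
    | refl => exact ⟨0, by simpa using hq⟩
    | head h1 _ ih =>
      obtain ⟨n, hn⟩ := ih
      refine ⟨n + 1, ?_⟩
      rw [pow_succ']
      exact hR _ (pf_iter_nonneg T hpos u hu n) _ _ h1 hn
  exact (Filter.eventually_all.2 key).exists

theorem pf_uniq {Q : Type*} [Finite Q] [Nonempty Q] (T : (Q → ℝ) →ₗ[ℝ] (Q → ℝ)) (R : Q → Q → Prop)
    (hpos : ∀ u, (∀ q, 0 ≤ u q) → ∀ q, 0 ≤ T u q)
    (hdiag : ∀ u, (∀ q, 0 ≤ u q) → ∀ q, 0 < u q → 0 < T u q)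
    (hR : ∀ u, (∀ q, 0 ≤ u q) → ∀ p q, R p q → 0 < u q → 0 < T u p)
    (hconn : ∀ p q, Relation.ReflTransGen R p q)
    (f g : Q → ℝ) (hf : ∀ q, 0 < f q) (hg : ∀ q, 0 < g q) (r s : ℝ)
    (hTf : T f = r • f) (hTg : T g = s • g) : r = s ∧ ∃ t : ℝ, f = t • g := by
  have key : ∀ (f g : Q → ℝ) (_ : ∀ q, 0 < f q) (_ : ∀ q, 0 < g q) (r s : ℝ)
      (_ : T f = r • f) (_ : T g = s • g), s ≤ r ∧ (s = r → ∃ t : ℝ, f = t • g) := by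
    intro f g hf hg r s hTf hTg
    obtain ⟨p, hp⟩ := Finite.exists_min (fun q => f q / g q)
    set t := f p / g p with ht
    have htp : f p = t * g p := by rw [ht]; field_simp [(hg p).ne']
    have hh : ∀ q, 0 ≤ (f - t • g) q := by
      intro q
      have := (le_div_iff₀ (hg q)).1 (hp q)
      simpa using this
    have hT : T (f - t • g) = r • f - (t * s) • g := by
      rw [map_sub, map_smul, hTf, hTg, smul_smul]
    constructor
    · have h1 := hpos _ hh p
      rw [hT] at h1
      simp only [Pi.sub_apply, Pi.smul_apply, smul_eq_mul] at h1
      have h2 : 0 ≤ (r - s) * f p := by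
        have : (r - s) * f p = r * f p - s * (t * g p) := by rw [← htp]; ring
        rw [this]; linarith
      have := nonneg_of_mul_nonneg_left h2 (hf p)
      linarith
    · rintro rfl
      refine ⟨t, ?_⟩
      by_contra hne
      obtain ⟨n, hn⟩ := pf_iter_pos T R hpos hdiag hR hconn _ hh (sub_ne_zero.2 hne)
      have h3 : ∀ n : ℕ, (T ^ n) (f - t • g) = s ^ n • (f - t • g) := by
        intro n
        induction n with
        | zero => simp
        | succ n ih =>
          rw [pow_succ', Module.End.mul_apply, ih, map_smul, hT, pow_succ]
          module
      have h4 := hn p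
      rw [h3] at h4
      simp [htp] at h4
  obtain ⟨h1, h2⟩ := key f g hf hg r s hTf hTg
  obtain ⟨h3, _⟩ := key g f hg hf s r hTg hTf
  have := le_antisymm h3 h1
  exact ⟨this, h2 this.symm⟩

theorem pf_exists {Q : Type*} [Fintype Q] [Nonempty Q] (T : (Q → ℝ) →ₗ[ℝ] (Q → ℝ)) (R : Q → Q → Prop)
    (hpos : ∀ u, (∀ q, 0 ≤ u q) → ∀ q, 0 ≤ T u q)
    (hdiag : ∀ u, (∀ q, 0 ≤ u q) → ∀ q, 0 < u q → 0 < T u q)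
    (hR : ∀ u, (∀ q, 0 ≤ u q) → ∀ p q, R p q → 0 < u q → 0 < T u p)
    (hconn : ∀ p q, Relation.ReflTransGen R p q) :
    ∃ (r : ℝ) (f : Q → ℝ), (∀ q, 0 < f q) ∧ T f = r • f := by
  have hTc : Continuous T := LinearMap.continuous_of_finiteDimensional T
  -- bound for the values
  have hcs : IsCompact (stdSimplex ℝ Q) := isCompact_stdSimplex ℝ Q
  obtain ⟨C, hC⟩ : ∃ C : ℝ, ∀ u ∈ stdSimplex ℝ Q, ∑ q, T u q ≤ C := by
    obtain ⟨C, hC⟩ := hcs.bddAbove_image (f := fun u => ∑ q, T u q)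
      (Continuous.continuousOn (by fun_prop))
    exact ⟨C, fun u hu => hC ⟨u, hu, rfl⟩⟩
  let S : Set (ℝ × (Q → ℝ)) :=
    (Set.Icc 0 C ×ˢ stdSimplex ℝ Q) ∩ {a | ∀ q, a.1 * a.2 q ≤ T a.2 q}
  have hSc : IsCompact S := by
    refine (isCompact_Icc.prod hcs).inter_right ?_
    simp only [Set.ofPred_forall]
    refine isClosed_iInter fun q => isClosed_le (by fun_prop) ?_
    exact (continuous_apply q).comp (hTc.comp continuous_snd)
  have hmem : ∀ (r : ℝ) (u : Q → ℝ), 0 ≤ r → u ∈ stdSimplex ℝ Q → (∀ q, r * u q ≤ T u q) →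
      (r, u) ∈ S := by
    intro r u hr hu h
    refine ⟨⟨⟨hr, ?_⟩, hu⟩, h⟩
    calc r = ∑ q, r * u q := by rw [← Finset.mul_sum, hu.2, mul_one]
      _ ≤ ∑ q, T u q := Finset.sum_le_sum fun q _ => h q
      _ ≤ C := hC u hu
  have hSne : S.Nonempty := by
    classical
    obtain ⟨q0⟩ := ‹Nonempty Q›
    have hq := single_mem_stdSimplex ℝ q0
    exact ⟨_, hmem 0 _ le_rfl hq fun q => by simpa using hpos _ hq.1 q⟩
  obtain ⟨⟨r, u⟩, hru, hmax⟩ := hSc.exists_isMaxOn hSne continuous_fst.continuousOn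
  have hr0 : 0 ≤ r := hru.1.1.1
  have hu : u ∈ stdSimplex ℝ Q := hru.1.2
  have hle : ∀ q, r * u q ≤ T u q := hru.2
  have hu0 : u ≠ 0 := by
    rintro rfl
    have := hu.2
    simp at this
  have heq : T u = r • u := by
    by_contra hne
    obtain ⟨n, hn⟩ := pf_iter_pos T R hpos hdiag hR hconn (T u - r • u)
      (fun q => by simpa using hle q) (sub_ne_zero.2 hne)
    set v := (T ^ n) u with hv
    have hv0 : ∀ q, 0 ≤ v q := pf_iter_nonneg T hpos u hu.1 n
    have hTv : ∀ q, r * v q < T v q := by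
      intro q
      have h := hn q
      have e : (T ^ n) (T u) = T v := by
        rw [hv, ← Module.End.mul_apply, ← Module.End.mul_apply, ← pow_succ, ← pow_succ']
      rw [map_sub, map_smul, e] at h
      simpa using h
    have hsum : 0 < ∑ q, v q := by
      refine lt_of_le_of_ne (Finset.sum_nonneg fun q _ => hv0 q) fun h0 => ?_
      have hz : v = 0 := by
        funext q
        exact (Finset.sum_eq_zero_iff_of_nonneg fun q _ => hv0 q).1 h0.symm q (Finset.mem_univ q)
      obtain ⟨q0⟩ := ‹Nonempty Q›
      have := hTv q0
      rw [hz] at this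
      simp at this
    have hev : ∀ᶠ s in nhdsWithin r (Set.Ioi r), ∀ q, s * v q < T v q := by
      refine Filter.eventually_all.2 fun q => ?_
      refine Filter.Eventually.filter_mono nhdsWithin_le_nhds ?_
      have : ContinuousAt (fun s : ℝ => s * v q) r := by fun_prop
      exact this.eventually_lt continuousAt_const (hTv q)
    obtain ⟨s, hs, hsr⟩ := (hev.and self_mem_nhdsWithin).exists
    have hsr : r < s := hsr
    have hw : (∑ q, v q)⁻¹ • v ∈ stdSimplex ℝ Q := by
      refine ⟨fun q => ?_, ?_⟩
      · exact mul_nonneg (inv_nonneg.2 hsum.le) (hv0 q)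
      · simp only [Pi.smul_apply, smul_eq_mul]
        rw [← Finset.mul_sum, inv_mul_cancel₀ hsum.ne']
    have hin := hmem s _ (hr0.trans hsr.le) hw (by
      intro q
      rw [map_smul]
      simp only [Pi.smul_apply, smul_eq_mul]
      have := mul_le_mul_of_nonneg_left (hs q).le (inv_nonneg.2 hsum.le)
      linarith)
    have := hmax hin
    simp at this
    linarith
  refine ⟨r, u, ?_, heq⟩
  obtain ⟨n, hn⟩ := pf_iter_pos T R hpos hdiag hR hconn u hu.1 hu0
  have h3 : ∀ n : ℕ, (T ^ n) u = r ^ n • u := by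
    intro n
    induction n with
    | zero => simp
    | succ n ih => rw [pow_succ', Module.End.mul_apply, ih, map_smul, heq, pow_succ, mul_smul]
  intro q
  have := hn q
  rw [h3] at this
  exact pos_of_mul_pos_right this (pow_nonneg hr0 n)

/-- For each `α ∈ ℝ^d` there are a unique `λ` and a unique positive
normalised multiplicative `λ`-harmonic function with character exponent `α`. -/
theorem exists_unique_multiplicative_eigenfunction {X : Type*} [Countable X] {d : ℕ}
    [AddAction (Fin d → ℤ) X]
    (b : X → X → ℝ) (c : X → ℝ)
    (hb0 : ∀ x y, 0 ≤ b x y) (hbd : ∀ x, b x x = 0) (hbs : ∀ x, Summable (b x))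
    (hlf : ∀ x : X, {y | 0 < b x y}.Finite) (hconn : Connected b)
    (hfree : ∀ (z : Fin d → ℤ) (x : X), z +ᵥ x = x → z = 0)
    (hcocpt : ∃ V : Finset X, ∀ x : X, ∃ z : Fin d → ℤ, ∃ v ∈ V, x = z +ᵥ v)
    (hbinv : ∀ (z : Fin d → ℤ) (x y : X), b (z +ᵥ x) (z +ᵥ y) = b x y)
    (hcinv : ∀ (z : Fin d → ℤ) (x : X), c (z +ᵥ x) = c x)
    (x₀ : X) (α : Fin d → ℝ) :
    ∃! p : ℝ × (X → ℝ),
      InDom b p.2 ∧ (∀ x, 0 < p.2 x) ∧ p.2 x₀ = 1 ∧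
      (schrodinger b c p.2 = fun x => p.1 * p.2 x) ∧
      (∀ (z : Fin d → ℤ) (x : X),
        p.2 (z +ᵥ x) = Real.exp (∑ k, α k * (z k : ℝ)) * p.2 x) := by
  classical
  let E : (Fin d → ℤ) → ℝ := fun z => Real.exp (∑ k, α k * (z k : ℝ))
  have hE0 : ∀ z, 0 < E z := fun z => Real.exp_pos _
  have hEz : E 0 = 1 := by simp [E]
  have hEadd : ∀ z z', E (z + z') = E z * E z' := by
    intro z z'
    simp only [E, ← Real.exp_add, ← Finset.sum_add_distrib]
    congr 1
    refine Finset.sum_congr rfl fun k _ => ?_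
    simp only [Pi.add_apply]
    push_cast
    ring
  -- the quotient
  let Q := AddAction.orbitRel.Quotient (Fin d → ℤ) X
  let q : X → Q := fun x => Quotient.mk _ x
  let s : Q → X := fun p => Quotient.out p
  have hqs : ∀ p, q (s p) = p := fun p => Quotient.out_eq p
  have hqinv : ∀ (z : Fin d → ℤ) (x : X), q (z +ᵥ x) = q x := by
    intro z x
    exact Quotient.sound ⟨z, rfl⟩
  have hzex : ∀ x, ∃ z : Fin d → ℤ, z +ᵥ s (q x) = x := by
    intro x
    have h : q x = q (s (q x)) := (hqs _).symm
    have h2 := Quotient.exact h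
    obtain ⟨z, hz⟩ := h2
    exact ⟨z, hz⟩
  choose ζ hζ using hzex
  have hcancel : ∀ (z z' : Fin d → ℤ) (x : X), z +ᵥ x = z' +ᵥ x → z = z' := by
    intro z z' x h
    have : (-z' + z) +ᵥ x = x := by rw [add_vadd, h, neg_vadd_vadd]
    have := hfree _ _ this
    exact (neg_add_eq_zero.1 this).symm
  have hζadd : ∀ (z : Fin d → ℤ) (x : X), ζ (z +ᵥ x) = z + ζ x := by
    intro z x
    apply hcancel _ _ (s (q x))
    rw [add_vadd, hζ x]
    have := hζ (z +ᵥ x)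
    rwa [hqinv] at this
  have hζs : ∀ p, ζ (s p) = 0 := by
    intro p
    apply hfree _ (s p)
    have := hζ (s p)
    rwa [hqs] at this
  let w : X → ℝ := fun x => E (ζ x)
  have hw0 : ∀ x, 0 < w x := fun x => hE0 _
  have hws : ∀ p, w (s p) = 1 := fun p => by simp only [w, hζs, hEz]
  have hwm : ∀ z x, w (z +ᵥ x) = E z * w x := fun z x => by simp only [w, hζadd, hEadd]
  have : Finite Q := by
    obtain ⟨V, hV⟩ := hcocpt
    refine Finite.of_surjective (fun v : V => q v.1) fun p => ?_
    obtain ⟨z, v, hv, h⟩ := hV (s p)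
    refine ⟨⟨v, hv⟩, ?_⟩
    rw [← hqs p, h, hqinv]
  have : Nonempty Q := ⟨q x₀⟩
  have : Fintype Q := Fintype.ofFinite Q
  let N : X → Finset X := fun x => (hlf x).toFinset
  have hN : ∀ x y, y ∉ N x → b x y = 0 := by
    intro x y h
    simp only [N, Set.Finite.mem_toFinset, Set.mem_ofPred_eq, not_lt] at h
    exact le_antisymm h (hb0 x y)
  have hHf : ∀ f x, schrodinger b c f x = ∑ y ∈ N x, b x y * (f x - f y) + c x * f x := by
    intro f x
    simp only [schrodinger]
    rw [tsum_eq_sum (s := N x)]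
    intro y hy
    rw [hN x y hy, zero_mul]
  have hdom : ∀ f, InDom b f := by
    intro f x
    refine summable_of_ne_finset_zero (s := N x) ?_
    intro y hy
    rw [hN x y hy, zero_mul]
  have hHinv : ∀ f : X → ℝ, (∀ z x, f (z +ᵥ x) = E z * f x) → ∀ z x,
      schrodinger b c f (z +ᵥ x) = E z * schrodinger b c f x := by
    intro f hf z x
    simp only [schrodinger]
    rw [← (AddAction.toPerm z : Equiv.Perm X).tsum_eq, mul_add, ← tsum_mul_left, hcinv, hf]
    congr 1
    · refine tsum_congr fun y => ?_
      simp only [AddAction.toPerm_apply]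
      rw [hbinv, hf]
      ring
    · ring
  let D : Q → ℝ := fun p => ∑ y ∈ N (s p), b (s p) y + c (s p)
  let K : ℝ := 1 + ∑ p, |D p|
  have hK : ∀ p, 0 < K - D p := by
    intro p
    have h1 : |D p| ≤ ∑ p, |D p| :=
      Finset.single_le_sum (f := fun p => |D p|) (fun _ _ => abs_nonneg _) (Finset.mem_univ p)
    have h2 := le_abs_self (D p)
    simp only [K]
    linarith
  let T : (Q → ℝ) →ₗ[ℝ] (Q → ℝ) :=
    { toFun := fun g p => (K - D p) * g p + ∑ y ∈ N (s p), b (s p) y * w y * g (q y)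
      map_add' := by
        intro g h
        funext p
        simp only [Pi.add_apply, mul_add, Finset.sum_add_distrib]
        ring
      map_smul' := by
        intro t g
        funext p
        simp only [Pi.smul_apply, smul_eq_mul, RingHom.id_apply, mul_add, Finset.mul_sum]
        congr 1
        · ring
        · exact Finset.sum_congr rfl fun y _ => by ring }
  have hTdef : ∀ g p, T g p = (K - D p) * g p + ∑ y ∈ N (s p), b (s p) y * w y * g (q y) :=
    fun g p => rfl
  have hsn : ∀ g : Q → ℝ, (∀ p, 0 ≤ g p) → ∀ p,
      0 ≤ ∑ y ∈ N (s p), b (s p) y * w y * g (q y) := fun g hg p =>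
    Finset.sum_nonneg fun y _ => mul_nonneg (mul_nonneg (hb0 _ _) (hw0 y).le) (hg _)
  let R : Q → Q → Prop := fun p p' => ∃ y, q y = p' ∧ 0 < b (s p) y
  have hpos : ∀ u, (∀ q, 0 ≤ u q) → ∀ q, 0 ≤ T u q := fun u hu p => by
    rw [hTdef]
    exact add_nonneg (mul_nonneg (hK p).le (hu p)) (hsn u hu p)
  have hdiag : ∀ u, (∀ q, 0 ≤ u q) → ∀ q, 0 < u q → 0 < T u q := fun u hu p hp => by
    rw [hTdef]
    exact add_pos_of_pos_of_nonneg (mul_pos (hK p) hp) (hsn u hu p)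
  have hR : ∀ u, (∀ q, 0 ≤ u q) → ∀ p q, R p q → 0 < u q → 0 < T u p := by
    rintro u hu p _ ⟨y, rfl, hy⟩ hq
    rw [hTdef]
    refine add_pos_of_nonneg_of_pos (mul_nonneg (hK p).le (hu p)) ?_
    refine Finset.sum_pos' (fun y _ => mul_nonneg (mul_nonneg (hb0 _ _) (hw0 y).le) (hu _))
      ⟨y, ?_, mul_pos (mul_pos hy (hw0 y)) hq⟩
    simpa [N] using hy
  have hRconn : ∀ p p', Relation.ReflTransGen R p p' := by
    intro p p'
    have h := Relation.ReflTransGen.lift (p := R) q (fun x y (hxy : 0 < b x y) => by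
      refine ⟨-ζ x +ᵥ y, hqinv _ _, ?_⟩
      rw [← hbinv (ζ x), hζ, vadd_neg_vadd]
      exact hxy) _ _ (hconn (s p) (s p'))
    simpa only [Function.onFun, hqs] using h
  -- relation between `T` and the operator
  have hTH : ∀ f : X → ℝ, (∀ z x, f (z +ᵥ x) = E z * f x) → ∀ p,
      T (fun p => f (s p)) p = K * f (s p) - schrodinger b c f (s p) := by
    intro f hf p
    have hfw : ∀ y, w y * f (s (q y)) = f y := by
      intro y
      rw [← hf, hζ]
    rw [hTdef, hHf]
    simp only [mul_assoc, hfw, D, mul_sub, Finset.sum_sub_distrib, ← Finset.sum_mul]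
    ring
  obtain ⟨r, g, hg, hTg⟩ := pf_exists T R hpos hdiag hR hRconn
  have hrec : ∀ f : X → ℝ, (∀ z x, f (z +ᵥ x) = E z * f x) → ∀ x, f x = w x * f (s (q x)) := by
    intro f hf x
    rw [← hf, hζ]
  let t : ℝ := (w x₀ * g (q x₀))⁻¹
  have ht : 0 < t := inv_pos.2 (mul_pos (hw0 _) (hg _))
  let F : X → ℝ := fun x => t * (w x * g (q x))
  have hFm : ∀ z x, F (z +ᵥ x) = E z * F x := by
    intro z x
    simp only [F, hwm, hqinv]
    ring
  have hFs : (fun p => F (s p)) = t • g := by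
    funext p
    simp [F, hws, hqs]
  have hFp : ∀ x, 0 < F x := fun x => mul_pos ht (mul_pos (hw0 x) (hg _))
  have hF0 : F x₀ = 1 := inv_mul_cancel₀ (mul_pos (hw0 _) (hg _)).ne'
  have hFT : T (fun p => F (s p)) = r • fun p => F (s p) := by
    rw [hFs, map_smul, hTg, smul_comm]
  refine ⟨(K - r, F), ⟨hdom _, hFp, hF0, ?_, hFm⟩, ?_⟩
  · funext x
    show schrodinger b c F x = (K - r) * F x
    rw [← hζ x, hHinv F hFm, hFm]
    have h1 := hTH F hFm (q x)
    rw [hFT] at h1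
    simp only [Pi.smul_apply, smul_eq_mul] at h1
    have h2 : schrodinger b c F (s (q x)) = (K - r) * F (s (q x)) := by linarith
    rw [h2]
    ring
  · rintro ⟨l, f⟩ ⟨-, hfp, hf0, hfH, hfm⟩
    simp only at hfp hf0 hfH hfm
    have hfm : ∀ z x, f (z +ᵥ x) = E z * f x := hfm
    have hfT : T (fun p => f (s p)) = (K - l) • fun p => f (s p) := by
      funext p
      rw [hTH f hfm, hfH]
      simp only [Pi.smul_apply, smul_eq_mul]
      ring
    obtain ⟨h1, τ, hτ⟩ := pf_uniq T R hpos hdiag hR hRconn (fun p => f (s p)) (fun p => F (s p))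
      (fun p => hfp _) (fun p => hFp _) _ _ hfT hFT
    have hfF : ∀ x, f x = τ * F x := by
      intro x
      rw [hrec f hfm x, hrec F hFm x]
      have := congrFun hτ (q x)
      simp only [Pi.smul_apply, smul_eq_mul] at this
      rw [this]
      ring
    have hτ1 : τ = 1 := by
      have := hfF x₀
      rw [hf0, hF0] at this
      linarith
    refine Prod.ext ?_ ?_
    · show l = K - r
      linarith
    · funext x
      show f x = F x
      rw [hfF, hτ1, one_mul]


end GraphPaper
end
end
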